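/- arXiv:1405.2527 — 4 statements merged into one kernel-verified Lean document; each statement's English description precedes it below -/
import Mathlib

section
/- Let K be a compact Hausdorff space. If the space P(K×K) of Radon probability measures on K×K, with its weak* topology, has countable tightness, then every Radon probability measure μ ∈ P(K) has countable Maharam type (equivalently, L¹(μ) is separable). -/
open MeasureTheory Set

noncomputable section

/-- A topological space has *countable tightness* if whenever `x` lies in the closure of a
set `A`, there is a countable `B ⊆ A` with `x` in the closure of `B`. -/
def CountablyTight (X : Type*) [TopologicalSpace X] : Prop :=
  ∀ (A : Set X) (x : X), x ∈ closure A →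
    ∃ B ⊆ A, B.Countable ∧ x ∈ closure B

/-- `P(K)`: the space of Radon probability measures on `K`, i.e. Borel probability
measures which are inner regular with respect to compact sets. -/
def RadonProb (K : Type*) [TopologicalSpace K] : Type _ :=
  { μ : @Measure K (borel K) //
      @IsProbabilityMeasure K (borel K) μ ∧ @Measure.InnerRegular K (borel K) _ μ }

/-- The weak* topology on `RadonProb K`: the coarsest topology making
`μ ↦ ∫ g dμ` continuous for every continuous `g : K → ℝ`. -/
instance (K : Type*) [TopologicalSpace K] : TopologicalSpace (RadonProb K) :=
  TopologicalSpace.induced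
    (fun (μ : RadonProb K) (g : C(K, ℝ)) => ∫ x, g x ∂μ.1) inferInstance

/-- A measure has *countable (Maharam) type* if there is a countable family `𝒞` of measurable
sets such that every measurable set can be approximated in measure by members of `𝒞`. -/
def HasCountableType {K : Type*} {m : MeasurableSpace K} (μ : Measure K) : Prop :=
  ∃ 𝒞 : Set (Set K), 𝒞.Countable ∧ (∀ C ∈ 𝒞, MeasurableSet C) ∧
    ∀ B : Set K, MeasurableSet B → ∀ ε : ENNReal, 0 < ε → ∃ C ∈ 𝒞, μ (symmDiff B C) < ε

/-- The *Maharam type* of a measure: the least cardinality of a family `𝒞` of measurable sets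
such that every measurable set can be approximated in measure by members of `𝒞`. -/
def maharamType {K : Type*} {m : MeasurableSpace K} (μ : Measure K) : Cardinal :=
  sInf {κ : Cardinal | ∃ 𝒞 : Set (Set K), Cardinal.mk 𝒞 = κ ∧ (∀ C ∈ 𝒞, MeasurableSet C) ∧
    ∀ B : Set K, MeasurableSet B → ∀ ε : ENNReal, 0 < ε → ∃ C ∈ 𝒞, μ (symmDiff B C) < ε}

/-- `μ` is homogeneous of Maharam type `ω₁`: its Maharam type is `ℵ₁` and the Maharam type of
its restriction to every measurable set of positive measure is `ℵ₁`. -/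
def IsHomogeneousOmega1 {K : Type*} {m : MeasurableSpace K} (μ : Measure K) : Prop :=
  maharamType μ = Cardinal.aleph 1 ∧
    ∀ B : Set K, MeasurableSet B → 0 < μ B →
      maharamType (μ.restrict B) = Cardinal.aleph 1

/-- A finitely additive probability measure on an algebra `𝒮` of subsets. -/
def IsFinAddProb {α : Type*} (𝒮 : Set (Set α)) (ν : Set α → ℝ) : Prop :=
  (∀ S ∈ 𝒮, 0 ≤ ν S) ∧ ν Set.univ = 1 ∧
    ∀ S ∈ 𝒮, ∀ T ∈ 𝒮, Disjoint S T → ν (S ∪ T) = ν S + ν T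

/-- `𝒜 ⊗ ℬ`: the algebra of subsets of `K × K` generated by rectangles `A ×ˢ B` with
`A ∈ 𝒜`, `B ∈ ℬ`. -/
def prodAlg {K : Type*} (𝒜 ℬ : Set (Set K)) : Set (Set (K × K)) :=
  MeasureTheory.generateSetAlgebra {S | ∃ A ∈ 𝒜, ∃ B ∈ ℬ, S = A ×ˢ B}

/-- The rectangle algebra `𝓡 = Bor(K) ⊗ Bor(K)` on `K × K`. -/
def rectAlgebra (K : Type*) [TopologicalSpace K] : Set (Set (K × K)) :=
  prodAlg {B : Set K | MeasurableSet[borel K] B} {B : Set K | MeasurableSet[borel K] B}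

/-- `ν` (a set function on `K × K`) has both marginals equal to `μ`. -/
def HasMarginals {K : Type*} [TopologicalSpace K] (ν : Set (K × K) → ℝ)
    (μ : @Measure K (borel K)) : Prop :=
  ∀ B : Set K, MeasurableSet[borel K] B →
    ν (B ×ˢ (Set.univ : Set K)) = (μ B).toReal ∧
    ν ((Set.univ : Set K) ×ˢ B) = (μ B).toReal

/-- Finite convex combinations of members of a set of Radon probability measures. -/
def ConvexCombinations {X : Type*} [TopologicalSpace X] (N : Set (RadonProb X)) :
    Set (RadonProb X) :=
  {ν | ∃ (n : ℕ) (t : Fin n → NNReal) (μs : Fin n → RadonProb X),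
      (∀ i, μs i ∈ N) ∧ (∑ i, t i) = 1 ∧ ν.1 = ∑ i, ((t i : ENNReal) • (μs i).1)}

/-- Property (C) of Corson: every family of closed convex sets with the countable
intersection property has nonempty intersection. -/
def PropertyC (X : Type*) [NormedAddCommGroup X] [NormedSpace ℝ X] : Prop :=
  ∀ 𝒞 : Set (Set X), (∀ C ∈ 𝒞, IsClosed C ∧ Convex ℝ C) →
    (∀ 𝒟 ⊆ 𝒞, 𝒟.Countable → (⋂₀ 𝒟).Nonempty) → (⋂₀ 𝒞).Nonempty

/-- Finite unions of closed rectangles in `K × K`. -/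
def closedRectUnions (K : Type*) [TopologicalSpace K] : Set (Set (K × K)) :=
  {L | ∃ (n : ℕ) (F F' : Fin n → Set K), (∀ i, IsClosed (F i)) ∧ (∀ i, IsClosed (F' i)) ∧
    L = ⋃ i, F i ×ˢ F' i}

/-- Riesz representation in the form needed here. -/
theorem exists_radonProb {X : Type*} [TopologicalSpace X] [CompactSpace X] [T2Space X]
    (L : C(X, ℝ) →ₗ[ℝ] ℝ) (hpos : ∀ f : C(X, ℝ), (∀ x, 0 ≤ f x) → 0 ≤ L f)
    (hone : L 1 = 1) :
    ∃ ν : RadonProb X, ∀ f : C(X, ℝ), ∫ x, f x ∂ν.1 = L f := by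
  let _ : MeasurableSpace X := borel X
  have : BorelSpace X := ⟨rfl⟩
  let T : CompactlySupportedContinuousMap X ℝ →ₗ[ℝ] C(X, ℝ) :=
    { toFun := fun f => f.toContinuousMap
      map_add' := fun _ _ => rfl
      map_smul' := fun _ _ => rfl }
  let Λ : CompactlySupportedContinuousMap X ℝ →ₚ[ℝ] ℝ :=
    PositiveLinearMap.mk₀ (L.comp T) (fun f hf => hpos _ (fun x => hf x))
  have key : ∀ f : C(X, ℝ), ∫ x, f x ∂(RealRMK.rieszMeasure Λ) = L f := fun f =>
    RealRMK.integral_rieszMeasure Λ (CompactlySupportedContinuousMap.continuousMapEquiv f)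
  refine ⟨⟨RealRMK.rieszMeasure Λ, ⟨?_⟩, inferInstance⟩, key⟩
  have h1 := key 1
  rw [hone] at h1
  simp only [ContinuousMap.one_apply, integral_const, smul_eq_mul, mul_one] at h1
  rw [measureReal_def] at h1
  rw [← ENNReal.toReal_eq_one_iff]
  exact h1

section Aux

variable {K : Type*} [TopologicalSpace K] [CompactSpace K] [MeasurableSpace K] [BorelSpace K]

theorem integrable_cont (μ : Measure K) [IsFiniteMeasure μ] (g : C(K, ℝ)) :
    Integrable (fun x => g x) μ :=
  Integrable.of_bound g.continuous.measurable.aestronglyMeasurable ‖g‖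
    (Filter.Eventually.of_forall fun x => g.norm_coe_le_norm x)

/-- Integration over `A` as a continuous functional. -/
def intCLM (μ : Measure K) [IsFiniteMeasure μ] (A : Set K) : C(K, ℝ) →L[ℝ] ℝ :=
  LinearMap.mkContinuous
    { toFun := fun g => ∫ x in A, g x ∂μ
      map_add' := fun f g => integral_add (integrable_cont _ f) (integrable_cont _ g)
      map_smul' := fun c g => integral_const_mul c _ }
    (μ.real A) (fun g => by
      have := norm_integral_le_of_norm_le_const (μ := μ.restrict A) (f := fun x => g x)
        (Filter.Eventually.of_forall fun x => g.norm_coe_le_norm x)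
      simpa [mul_comm] using this)

theorem intCLM_apply (μ : Measure K) [IsFiniteMeasure μ] (A : Set K) (g : C(K, ℝ)) :
    intCLM μ A g = ∫ x in A, g x ∂μ := rfl

/-- The inner partial integral, as a continuous function. -/
def innerInt (μ : Measure K) [IsFiniteMeasure μ] (A : Set K) (f : C(K × K, ℝ)) : C(K, ℝ) :=
  ⟨fun x => intCLM μ A (f.curry x), (intCLM μ A).continuous.comp f.curry.continuous⟩

theorem innerInt_apply (μ : Measure K) [IsFiniteMeasure μ] (A : Set K) (f : C(K × K, ℝ)) (x : K) :
    innerInt μ A f x = ∫ y in A, f (x, y) ∂μ := rfl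

/-- The functional of the averaged measure attached to a finite family. -/
def partL (μ : Measure K) [IsFiniteMeasure μ] {n : ℕ} (A : Fin n → Set K) :
    C(K × K, ℝ) →ₗ[ℝ] ℝ where
  toFun f := ∑ i, (μ.real (A i))⁻¹ * intCLM μ (A i) (innerInt μ (A i) f)
  map_add' f g := by
    rw [← Finset.sum_add_distrib]
    refine Finset.sum_congr rfl fun i _ => ?_
    have : innerInt μ (A i) (f + g) = innerInt μ (A i) f + innerInt μ (A i) g := by
      ext x
      exact (intCLM μ (A i)).map_add (f.curry x) (g.curry x)
    rw [this, map_add, mul_add]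
  map_smul' c f := by
    rw [RingHom.id_apply, smul_eq_mul, Finset.mul_sum]
    refine Finset.sum_congr rfl fun i _ => ?_
    have : innerInt μ (A i) (c • f) = c • innerInt μ (A i) f := by
      ext x
      exact (intCLM μ (A i)).map_smul c (f.curry x)
    rw [this, map_smul, smul_eq_mul]
    ring

theorem partL_apply (μ : Measure K) [IsFiniteMeasure μ] {n : ℕ} (A : Fin n → Set K)
    (f : C(K × K, ℝ)) :
    partL μ A f = ∑ i, (μ.real (A i))⁻¹ * ∫ x in A i, ∫ y in A i, f (x, y) ∂μ ∂μ := rfl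

theorem partL_nonneg (μ : Measure K) [IsFiniteMeasure μ] {n : ℕ} (A : Fin n → Set K)
    (f : C(K × K, ℝ)) (hf : ∀ x, 0 ≤ f x) : 0 ≤ partL μ A f := by
  rw [partL_apply]
  refine Finset.sum_nonneg fun i _ => mul_nonneg (by positivity) ?_
  exact integral_nonneg fun x => integral_nonneg fun y => hf _

/-- A finite measurable partition. -/
structure IsPart {n : ℕ} (A : Fin n → Set K) : Prop where
  meas : ∀ i, MeasurableSet (A i)
  disj : Pairwise (Function.onFun Disjoint A)
  cover : ⋃ i, A i = univ

theorem IsPart.integral_eq {n : ℕ} {A : Fin n → Set K} (hA : IsPart A) (μ : Measure K)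
    [IsFiniteMeasure μ] (g : C(K, ℝ)) : ∫ x, g x ∂μ = ∑ i, ∫ x in A i, g x ∂μ := by
  have := integral_biUnion_finset (μ := μ) (f := fun x => g x) Finset.univ (s := A)
    (fun i _ => hA.meas i) (hA.disj.set_pairwise _) (fun i _ => (integrable_cont μ g).integrableOn)
  rw [← this]
  simp [hA.cover]

theorem IsPart.sum_real {n : ℕ} {A : Fin n → Set K} (hA : IsPart A) (μ : Measure K)
    [IsProbabilityMeasure μ] : ∑ i, μ.real (A i) = 1 := by
  have := hA.integral_eq μ 1
  simpa using this.symm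

theorem IsPart.partL_one {n : ℕ} {A : Fin n → Set K} (hA : IsPart A) (μ : Measure K)
    [IsProbabilityMeasure μ] : partL μ A 1 = 1 := by
  rw [partL_apply, ← hA.sum_real μ]
  refine Finset.sum_congr rfl fun i _ => ?_
  simp only [ContinuousMap.one_apply, integral_const, smul_eq_mul, mul_one, measureReal_restrict_apply_univ]
  by_cases h : μ.real (A i) = 0
  · simp [h]
  · field_simp

/-- The functional of the diagonal measure. -/
def diagL (μ : Measure K) [IsFiniteMeasure μ] : C(K × K, ℝ) →ₗ[ℝ] ℝ where
  toFun f := ∫ x, f (x, x) ∂μ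
  map_add' f g := integral_add (integrable_cont μ (f.comp ⟨fun x => (x, x), by fun_prop⟩))
    (integrable_cont μ (g.comp ⟨fun x => (x, x), by fun_prop⟩))
  map_smul' c f := integral_const_mul c _

theorem diagL_apply (μ : Measure K) [IsFiniteMeasure μ] (f : C(K × K, ℝ)) :
    diagL μ f = ∫ x, f (x, x) ∂μ := rfl

theorem partL_close (μ : Measure K) [IsProbabilityMeasure μ] {n : ℕ} {A : Fin n → Set K}
    (hA : IsPart A) (f : C(K × K, ℝ)) (ε : ℝ)
    (hf : ∀ i, ∀ x ∈ A i, ∀ y ∈ A i, |f (x, y) - f (x, x)| ≤ ε) :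
    |partL μ A f - diagL μ f| ≤ ε := by
  let d : C(K, ℝ) := f.comp ⟨fun x => (x, x), by fun_prop⟩
  have hd : diagL μ f = ∑ i, ∫ x in A i, d x ∂μ := hA.integral_eq μ d
  rw [hd, partL_apply, ← Finset.sum_sub_distrib]
  refine (Finset.abs_sum_le_sum_abs _ _).trans ?_
  have : ε = ∑ i, ε * μ.real (A i) := by rw [← Finset.mul_sum, hA.sum_real, mul_one]
  rw [this]
  refine Finset.sum_le_sum fun i _ => ?_
  by_cases h : μ.real (A i) = 0
  · have h0 : μ (A i) = 0 := by
      simpa [measureReal_def, ENNReal.toReal_eq_zero_iff] using h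
    simp [h, Measure.restrict_eq_zero.2 h0]
  have hpos : 0 < μ.real (A i) := lt_of_le_of_ne measureReal_nonneg (Ne.symm h)
  have h1 : (∫ x in A i, ∫ y in A i, f (x, y) ∂μ ∂μ) - μ.real (A i) * ∫ x in A i, d x ∂μ
      = ∫ x in A i, (∫ y in A i, f (x, y) ∂μ) - μ.real (A i) * d x ∂μ := by
    rw [← integral_const_mul, ← integral_sub]
    · exact integrable_cont _ (innerInt μ (A i) f)
    · exact (integrable_cont _ d).const_mul _
  have h2 : ∀ x ∈ A i, ‖(∫ y in A i, f (x, y) ∂μ) - μ.real (A i) * d x‖ ≤ ε * μ.real (A i) := by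
    intro x hx
    have : (∫ y in A i, f (x, y) ∂μ) - μ.real (A i) * d x
        = ∫ y in A i, (f (x, y) - f (x, x)) ∂μ := by
      have hsub := integral_sub (μ := μ.restrict (A i)) (f := fun y => f (x, y))
        (g := fun _ => f (x, x)) (integrable_cont _ (f.curry x)) (integrable_const _)
      rw [hsub]
      simp [d]
    rw [this]
    exact norm_setIntegral_le_of_norm_le_const (measure_lt_top _ _)
      (fun y hy => hf i x hx y hy)
  have h3 := norm_setIntegral_le_of_norm_le_const (μ := μ) (s := A i) (measure_lt_top _ _) h2
  rw [← h1, Real.norm_eq_abs] at h3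
  have h4 : (μ.real (A i))⁻¹ * (∫ x in A i, ∫ y in A i, f (x, y) ∂μ ∂μ) - ∫ x in A i, d x ∂μ
      = (μ.real (A i))⁻¹ * ((∫ x in A i, ∫ y in A i, f (x, y) ∂μ ∂μ)
        - μ.real (A i) * ∫ x in A i, d x ∂μ) := by
    field_simp
  rw [h4, abs_mul, abs_of_pos (inv_pos.2 hpos)]
  calc _ ≤ (μ.real (A i))⁻¹ * (ε * μ.real (A i) * μ.real (A i)) := by gcongr
    _ = _ := by field_simp

theorem exists_part (I : Set C(K × K, ℝ)) (hI : I.Finite) (ε : ℝ) (hε : 0 < ε) :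
    ∃ (n : ℕ) (A : Fin n → Set K), IsPart A ∧
      ∀ f ∈ I, ∀ i, ∀ x ∈ A i, ∀ y ∈ A i, |f (x, y) - f (x, x)| ≤ ε := by
  let W : Set (K × K) := ⋂ f ∈ I, {p | |f p - f (p.1, p.1)| < ε}
  have hW : IsOpen W := by
    refine hI.isOpen_biInter fun f _ => ?_
    exact isOpen_lt (by fun_prop) continuous_const
  have hloc : ∀ x : K, ∃ U : Set K, IsOpen U ∧ x ∈ U ∧ U ×ˢ U ⊆ W := by
    intro x
    have hx : (x, x) ∈ W := by simp [W, hε]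
    obtain ⟨u, v, hu, hv, hxu, hxv, huv⟩ := isOpen_prod_iff.1 hW x x hx
    exact ⟨u ∩ v, hu.inter hv, ⟨hxu, hxv⟩, fun p hp => huv ⟨hp.1.1, hp.2.2⟩⟩
  choose U hU hxU hUW using hloc
  obtain ⟨t, ht⟩ := isCompact_univ.elim_finite_subcover U hU
    (fun x _ => mem_iUnion.2 ⟨x, hxU x⟩)
  let V : Fin t.card → Set K := fun i => U (t.equivFin.symm i)
  refine ⟨t.card, disjointed V, ⟨fun i => ?_, disjoint_disjointed V, ?_⟩, ?_⟩
  · exact disjointedRec (p := fun s => MeasurableSet s)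
      (fun s j hs => hs.diff (hU _).measurableSet) (hU _).measurableSet
  · rw [iUnion_disjointed, eq_univ_iff_forall]
    intro x
    obtain ⟨z, hz, hxz⟩ := mem_iUnion₂.1 (ht (mem_univ x))
    exact mem_iUnion.2 ⟨t.equivFin ⟨z, hz⟩, by simpa [V] using hxz⟩
  · intro f hf i x hx y hy
    have := hUW _ (show (x, y) ∈ _ from ⟨disjointed_subset V i hx, disjointed_subset V i hy⟩)
    exact le_of_lt (mem_iInter₂.1 this f hf)

/-- The key measure estimate. -/
theorem approx_of_part [T2Space K] (μ : Measure K) [IsProbabilityMeasure μ] {n : ℕ}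
    {A : Fin n → Set K} (hA : IsPart A) (g : C(K, ℝ)) (B D : Set K)
    (h1 : ∀ x ∈ B, x ∉ D → g x = 1) (h0 : ∀ x, x ∉ B → x ∉ D → g x = 0) :
    ∃ S : Finset (Fin n), μ.real (symmDiff B (⋃ i ∈ S, A i)) ≤
      μ.real D + 4 * (∫ x, g x * g x ∂μ - ∑ i, (μ.real (A i))⁻¹ * (∫ x in A i, g x ∂μ) ^ 2) := by
  classical
  let c : Fin n → ℝ := fun i => (μ.real (A i))⁻¹ * ∫ x in A i, g x ∂μ
  refine ⟨Finset.univ.filter fun i => 1 / 2 ≤ c i, ?_⟩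
  let q : Fin n → C(K, ℝ) := fun i => (g - ContinuousMap.const K (c i)) ^ 2
  let E : Fin n → Set K := fun i => A i ∩ {x | 1 / 4 ≤ q i x}
  have hsub : symmDiff B (⋃ i ∈ Finset.univ.filter fun i => 1 / 2 ≤ c i, A i) ⊆ D ∪ ⋃ i, E i := by
    intro x hx
    by_cases hxD : x ∈ D
    · exact Or.inl hxD
    right
    obtain ⟨i, hi⟩ := mem_iUnion.1 (hA.cover ▸ mem_univ x : x ∈ ⋃ i, A i)
    refine mem_iUnion.2 ⟨i, hi, ?_⟩
    have hq : q i x = (g x - c i) ^ 2 := rfl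
    rw [mem_ofPred_eq, hq]
    rcases hx with ⟨hB, hC⟩ | ⟨hC, hB⟩
    · rw [h1 x hB hxD]
      have : c i < 1 / 2 := by
        by_contra hc
        exact hC (mem_iUnion₂.2 ⟨i, by simpa using not_lt.1 hc, hi⟩)
      nlinarith
    · rw [h0 x hB hxD]
      obtain ⟨j, hj, hxj⟩ := mem_iUnion₂.1 hC
      have hij : j = i := by
        by_contra hne
        exact Set.disjoint_left.1 (hA.disj hne) hxj hi
      subst hij
      have : 1 / 2 ≤ c j := (Finset.mem_filter.1 hj).2
      nlinarith
  have hE : ∀ i, μ.real (E i) ≤ 4 * ((∫ x in A i, g x * g x ∂μ)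
      - (μ.real (A i))⁻¹ * (∫ x in A i, g x ∂μ) ^ 2) := by
    intro i
    have hm := mul_meas_ge_le_integral_of_nonneg (μ := μ.restrict (A i)) (f := fun x => q i x)
      (Filter.Eventually.of_forall fun x => sq_nonneg (g x - c i)) (integrable_cont _ _) (1 / 4)
    have hms : MeasurableSet {x | 1 / 4 ≤ q i x} :=
      (isClosed_le continuous_const (q i).continuous).measurableSet
    rw [measureReal_restrict_apply hms, inter_comm] at hm
    have hint : ∫ x in A i, q i x ∂μ = (∫ x in A i, g x * g x ∂μ)
        - 2 * c i * (∫ x in A i, g x ∂μ) + c i ^ 2 * μ.real (A i) := by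
      have e : ∀ x, q i x = (g * g) x - 2 * c i * g x + c i ^ 2 := by
        intro x
        have hq : q i x = (g x - c i) ^ 2 := rfl
        rw [hq, ContinuousMap.mul_apply]; ring
      simp_rw [e]
      rw [integral_add, integral_sub, integral_const_mul]
      · simp [mul_comm]
      · exact integrable_cont _ _
      · exact (integrable_cont _ g).const_mul _
      · exact (integrable_cont _ _).sub ((integrable_cont _ g).const_mul _)
      · exact integrable_const _
    rw [hint] at hm
    have hc : - 2 * c i * (∫ x in A i, g x ∂μ) + c i ^ 2 * μ.real (A i)
        = - ((μ.real (A i))⁻¹ * (∫ x in A i, g x ∂μ) ^ 2) := by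
      simp only [c]
      by_cases h : μ.real (A i) = 0
      · simp [h]
      · field_simp
        ring
    simp only [E]
    linarith
  calc _ ≤ μ.real (D ∪ ⋃ i, E i) := measureReal_mono hsub
    _ ≤ μ.real D + μ.real (⋃ i, E i) := measureReal_union_le _ _
    _ ≤ μ.real D + ∑ i, μ.real (E i) := by
        gcongr
        exact measureReal_iUnion_fintype_le _
    _ ≤ μ.real D + ∑ i, 4 * ((∫ x in A i, g x * g x ∂μ)
      - (μ.real (A i))⁻¹ * (∫ x in A i, g x ∂μ) ^ 2) := by
        gcongr with i
        exact hE i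
    _ = _ := by
        rw [← Finset.mul_sum, Finset.sum_sub_distrib]
        have := hA.integral_eq μ (g * g)
        simp only [ContinuousMap.mul_apply] at this
        rw [this]

end Aux

/-- If `P(K × K)` has countable tightness in the weak* topology, then every Radon
probability measure on `K` has countable Maharam type. -/
theorem stmt0 (K : Type*) [TopologicalSpace K] [CompactSpace K] [T2Space K]
    (h : CountablyTight (RadonProb (K × K))) :
    ∀ μ : RadonProb K, HasCountableType μ.1 := by
  intro ⟨μ, hμp, hμr⟩
  let _ : MeasurableSpace K := borel K
  have : BorelSpace K := ⟨rfl⟩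
  change HasCountableType μ
  have : IsProbabilityMeasure μ := hμp
  have : μ.InnerRegular := hμr
  obtain ⟨δ, hδ⟩ := exists_radonProb (diagL μ)
    (fun f hf => integral_nonneg fun x => hf _) (by simp [diagL_apply])
  let 𝒩 : Set (RadonProb (K × K)) := {ν | ∃ (n : ℕ) (A : Fin n → Set K), IsPart A ∧
    ∀ f : C(K × K, ℝ), ∫ x, f x ∂ν.1 = partL μ A f}
  have hind : Topology.IsInducing
      (fun (μ : RadonProb (K × K)) (g : C(K × K, ℝ)) => ∫ x, g x ∂μ.1) := ⟨rfl⟩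
  have hcl : δ ∈ closure 𝒩 := by
    rw [hind.closure_eq_preimage_closure_image, mem_preimage]
    rw [mem_closure_iff_nhds_basis
      (by rw [nhds_pi]; exact Filter.hasBasis_pi fun g => Metric.nhds_basis_ball)]
    rintro ⟨I, r⟩ ⟨hI, hr⟩
    obtain ⟨ε, hε, hεr⟩ : ∃ ε : ℝ, 0 < ε ∧ ∀ f ∈ I, ε < r f := by
      rcases I.eq_empty_or_nonempty with rfl | hne
      · exact ⟨1, one_pos, by simp⟩
      obtain ⟨f0, hf0, hmin⟩ := hI.exists_minimalFor r I hne
      have hr0 := hr f0 hf0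
      refine ⟨r f0 / 2, by positivity, fun f hf => ?_⟩
      have : r f0 ≤ r f := by
        rcases le_total (r f0) (r f) with h | h
        · exact h
        · exact hmin hf h
      have : 0 < r f0 := hr0
      linarith
    obtain ⟨n, A, hA, hAf⟩ := exists_part I hI ε hε
    obtain ⟨ν, hν⟩ := exists_radonProb (partL μ A) (partL_nonneg μ A) (hA.partL_one μ)
    refine ⟨_, ⟨ν, ⟨n, A, hA, hν⟩, rfl⟩, fun f hf => ?_⟩
    rw [Metric.mem_ball, Real.dist_eq]
    have key : |(∫ x, f x ∂ν.1) - ∫ x, f x ∂δ.1| < r f := by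
      rw [hν f, hδ f]
      exact (partL_close μ hA f ε (hAf f hf)).trans_lt (hεr f hf)
    exact key
  obtain ⟨ℬ, hℬ, hℬc, hδℬ⟩ := h 𝒩 δ hcl
  have hBparts : ∀ ν ∈ ℬ, ∃ (n : ℕ) (A : Fin n → Set K), IsPart A ∧
    ∀ f : C(K × K, ℝ), ∫ x, f x ∂ν.1 = partL μ A f := fun ν hν => hℬ hν
  choose! n A hA hν using hBparts
  refine ⟨⋃ ν ∈ ℬ, range fun S : Finset (Fin (n ν)) => ⋃ i ∈ S, A ν i, ?_, ?_, ?_⟩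
  · exact hℬc.biUnion fun ν _ => countable_range _
  · intro C hC
    obtain ⟨ν, hνB, S, rfl⟩ := mem_iUnion₂.1 hC
    exact Finset.measurableSet_biUnion _ fun i _ => (hA ν hνB).meas i
  intro B hB ε hε
  obtain ⟨e, he, heε⟩ : ∃ e : ℝ, 0 < e ∧ ENNReal.ofReal (6 * e) < ε := by
    obtain ⟨e, he0, he⟩ := ENNReal.lt_iff_exists_real_btwn.1 hε
    have : 0 < e := ENNReal.ofReal_pos.1 he.1
    exact ⟨e / 6, by positivity, by rw [mul_div_cancel₀ _ (by norm_num)]; exact he.2⟩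
  have hee : ENNReal.ofReal e ≠ 0 := by simpa using he
  obtain ⟨F, hFB, hF, hμF⟩ := hB.exists_isClosed_sdiff_lt (μ := μ) (measure_ne_top _ _) hee
  obtain ⟨U, hBU, hU, -, hμU⟩ := hB.exists_isOpen_sdiff_lt (μ := μ) (measure_ne_top _ _) hee
  obtain ⟨g, hg0, hg1, -⟩ := exists_continuous_zero_one_of_isClosed hU.isClosed_compl hF
    (Set.disjoint_left.2 fun x hx hxF => hx (hBU (hFB hxF)))
  let D : Set K := (B \ F) ∪ (U \ B)
  have hD : μ.real D ≤ 2 * e := by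
    refine (measureReal_union_le _ _).trans ?_
    have a1 : μ.real (B \ F) ≤ e := ENNReal.toReal_le_of_le_ofReal he.le hμF.le
    have a2 : μ.real (U \ B) ≤ e := ENNReal.toReal_le_of_le_ofReal he.le hμU.le
    linarith
  let gg : C(K × K, ℝ) := ⟨fun p => g p.1 * g p.2, by fun_prop⟩
  obtain ⟨ν, hνe, hνB⟩ : ∃ ν : RadonProb (K × K),
      |∫ p, gg p ∂ν.1 - ∫ p, gg p ∂δ.1| < e ∧ ν ∈ ℬ := by
    have hc : Continuous fun ν : RadonProb (K × K) => ∫ p, gg p ∂ν.1 :=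
      (continuous_apply gg).comp hind.continuous
    have ho : IsOpen {ν : RadonProb (K × K) | |∫ p, gg p ∂ν.1 - ∫ p, gg p ∂δ.1| < e} :=
      isOpen_lt ((hc.sub continuous_const).abs) continuous_const
    have hδm : |∫ p, gg p ∂δ.1 - ∫ p, gg p ∂δ.1| < e := by rwa [sub_self, abs_zero]
    exact mem_closure_iff.1 hδℬ _ ho hδm
  obtain ⟨S, hS⟩ := approx_of_part μ (hA ν hνB) g B D
    (fun x hxB hxD => hg1 (by
      by_contra hxF
      exact hxD (Or.inl ⟨hxB, hxF⟩)))
    (fun x hxB hxD => hg0 (fun hxU => hxD (Or.inr ⟨hxU, hxB⟩)))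
  refine ⟨_, mem_iUnion₂.2 ⟨ν, hνB, S, rfl⟩, ?_⟩
  have e1 : ∫ p, gg p ∂ν.1 = ∑ i, (μ.real (A ν i))⁻¹ * (∫ x in A ν i, g x ∂μ) ^ 2 := by
    rw [hν ν hνB gg, partL_apply]
    refine Finset.sum_congr rfl fun i _ => ?_
    simp only [gg, ContinuousMap.coe_mk, integral_const_mul, integral_mul_const]
    ring
  have e2 : ∫ p, gg p ∂δ.1 = ∫ x, g x * g x ∂μ := by
    rw [hδ gg, diagL_apply]
    rfl
  rw [e1, e2] at hνe
  have := (abs_lt.1 hνe).1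
  refine lt_of_le_of_lt ?_ heε
  rw [← ENNReal.ofReal_toReal (measure_ne_top μ _)]
  refine ENNReal.ofReal_le_ofReal ?_
  rw [← measureReal_def]
  linarith
end
end

section
/- Let K and L be compact Hausdorff spaces such that K carries a Radon probability measure of uncountable Maharam type and L carries a Radon probability measure of uncountable Maharam type. Then the space P(K×L) of Radon probability measures on K×L with the weak* topology does not have countable tightness. -/
open MeasureTheory Set

noncomputable section

/-- Exhaustion. -/
lemma exhaustion {Ω : Type*} [MeasurableSpace Ω] (μ : Measure Ω) [IsProbabilityMeasure μ]
    (P : Set Ω → Prop) (h0 : ∃ A, P A) (hm : ∀ A, P A → MeasurableSet A)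
    (hU : ∀ A : ℕ → Set Ω, (∀ n, P (A n)) → P (⋃ n, A n)) :
    ∃ B, P B ∧ ∀ C, P C → μ (C \ B) = 0 := by
  set s : Set ENNReal := μ '' {A | P A} with hs
  have hne : s.Nonempty := by
    obtain ⟨A, hA⟩ := h0
    exact ⟨_, A, hA, rfl⟩
  obtain ⟨u, -, hu, hus⟩ := exists_seq_tendsto_sSup hne (OrderTop.bddAbove s)
  choose A hA hAu using hus
  refine ⟨⋃ n, A n, hU A hA, fun C hC => ?_⟩
  set B := ⋃ n, A n with hB
  have hBP : P B := hU A hA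
  have h1 : sSup s ≤ μ B := by
    refine le_of_tendsto' hu fun n => ?_
    rw [← hAu n]
    exact measure_mono (subset_iUnion A n)
  have h2 : P (C ∪ B) := by
    have := hU (fun n => if n = 0 then C else B) (by intro n; split_ifs <;> assumption)
    convert this using 1
    ext x
    simp only [mem_union, mem_iUnion]
    constructor
    · rintro (h | h)
      · exact ⟨0, by simpa using h⟩
      · exact ⟨1, by simpa using h⟩
    · rintro ⟨n, hn⟩
      split_ifs at hn
      · exact Or.inl hn
      · exact Or.inr hn
  have h3 : μ (C ∪ B) ≤ μ B := (le_sSup (show μ (C ∪ B) ∈ s from ⟨_, h2, rfl⟩)).trans h1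
  rw [← sdiff_union_self, measure_union disjoint_sdiff_left (hm _ hBP)] at h3
  have h4 : μ B ≠ ⊤ := measure_ne_top _ _
  by_contra hcon
  have : μ B < μ (C \ B) + μ B := by
    rw [add_comm]
    exact ENNReal.lt_add_right h4 hcon
  exact absurd h3 (not_le.mpr this)

/-- `A` is determined by a countably generated sub-σ-algebra. -/
def Det {Ω : Type*} [MeasurableSpace Ω] (μ : Measure Ω) (A : Set Ω) : Prop :=
  MeasurableSet A ∧ ∃ 𝒢 : Set (Set Ω), 𝒢.Countable ∧ (∀ G ∈ 𝒢, MeasurableSet G) ∧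
    ∀ B, MeasurableSet B → ∃ C, MeasurableSet[MeasurableSpace.generateFrom 𝒢] C ∧
      ∀ᵐ x ∂μ, x ∈ A → (x ∈ B ↔ x ∈ C)

lemma Det.iUnion {Ω : Type*} [MeasurableSpace Ω] (μ : Measure Ω) (A : ℕ → Set Ω)
    (h : ∀ n, Det μ (A n)) : Det μ (⋃ n, A n) := by
  choose hA 𝒢 hc hm hd using h
  refine ⟨.iUnion hA, (⋃ n, 𝒢 n) ∪ range A, (countable_iUnion hc).union (countable_range A), ?_, ?_⟩
  · rintro G (hG | ⟨n, rfl⟩)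
    · obtain ⟨n, hn⟩ := mem_iUnion.mp hG
      exact hm n _ hn
    · exact hA n
  · intro B hB
    choose C hC hCB using fun n => hd n B hB
    refine ⟨⋃ n, C n ∩ disjointed A n, ?_, ?_⟩
    · refine MeasurableSet.iUnion fun n => MeasurableSet.inter ?_ ?_
      · have : MeasurableSpace.generateFrom (𝒢 n) ≤
            MeasurableSpace.generateFrom ((⋃ n, 𝒢 n) ∪ range A) :=
          MeasurableSpace.generateFrom_mono
            ((subset_iUnion 𝒢 n).trans subset_union_left)
        exact this _ (hC n)
      · refine MeasurableSet.disjointed (fun k => ?_) n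
        exact MeasurableSpace.measurableSet_generateFrom (Or.inr ⟨k, rfl⟩)
    · filter_upwards [ae_all_iff.mpr hCB] with x hx hxA
      rw [← iUnion_disjointed] at hxA
      obtain ⟨n, hn⟩ := mem_iUnion.mp hxA
      constructor
      · intro hxB
        exact mem_iUnion.mpr ⟨n, (hx n (disjointed_subset A n hn)).mp hxB, hn⟩
      · intro h
        obtain ⟨k, hk, hk'⟩ := mem_iUnion.mp h
        exact (hx k (disjointed_subset A k hk')).mpr hk

lemma hasCountableType_of_det {Ω : Type*} [MeasurableSpace Ω] (μ : Measure Ω)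
    [IsProbabilityMeasure μ] (h : Det μ univ) : HasCountableType μ := by
  obtain ⟨-, 𝒢, hc, hm, hd⟩ := h
  have hle : MeasurableSpace.generateFrom 𝒢 ≤ ‹MeasurableSpace Ω› :=
    MeasurableSpace.generateFrom_le hm
  have hdense := @Measure.MeasureDense.of_generateFrom_isSetAlgebra_finite Ω
    (MeasurableSpace.generateFrom 𝒢) (μ.trim hle) (generateSetAlgebra 𝒢) _
    isSetAlgebra_generateSetAlgebra generateFrom_generateSetAlgebra_eq.symm
  have hms : ∀ C ∈ generateSetAlgebra 𝒢, MeasurableSet[MeasurableSpace.generateFrom 𝒢] C :=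
    fun C hC => @Measure.MeasureDense.measurable _ (_) _ _ hdense C hC
  refine ⟨generateSetAlgebra 𝒢, countable_generateSetAlgebra hc, fun C hC => hle _ (hms C hC), ?_⟩
  intro B hB ε hε
  obtain ⟨C, hC, hBC⟩ := hd B hB
  have hε' : 0 < min ε 1 := lt_min hε one_pos
  obtain ⟨D, hD, hCD⟩ := @Measure.MeasureDense.approx _ (_) _ _ hdense C hC
    (@measure_ne_top _ (MeasurableSpace.generateFrom 𝒢) _ (isFiniteMeasure_trim hle) _) (min ε 1).toReal
    (ENNReal.toReal_pos hε'.ne' (by simp))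
  refine ⟨D, hD, ?_⟩
  rw [ENNReal.ofReal_toReal (by simp), trim_measurableSet_eq hle (hC.symmDiff (hms D hD))] at hCD
  have : μ (symmDiff B D) = μ (symmDiff C D) := by
    refine measure_congr ?_
    filter_upwards [hBC] with x hx
    have := hx trivial
    refine propext ?_
    change x ∈ symmDiff B D ↔ x ∈ symmDiff C D
    simp only [mem_symmDiff, this]
  rw [this]
  exact hCD.trans_le (min_le_left _ _)

/-- Nowhere of countable type. -/
def Nowhere {Ω : Type*} [MeasurableSpace Ω] (μ : Measure Ω) : Prop := ∀ A, Det μ A → μ A = 0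

lemma exists_nowhere {Ω : Type*} [MeasurableSpace Ω] (μ : Measure Ω)
    [IsProbabilityMeasure μ] (h : ¬ HasCountableType μ) :
    ∃ D, MeasurableSet D ∧ μ D ≠ 0 ∧ Nowhere ((μ D)⁻¹ • μ.restrict D) := by
  obtain ⟨B, hB, hmax⟩ := exhaustion μ (Det μ) ⟨∅, .empty, ∅, countable_empty, by simp,
    fun B hB => ⟨∅, @MeasurableSet.empty _ (_), by simp⟩⟩ (fun A hA => hA.1) (Det.iUnion μ)
  have hD : μ Bᶜ ≠ 0 := by
    intro h0
    apply h
    apply hasCountableType_of_det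
    obtain ⟨hBm, 𝒢, hc, hm, hd⟩ := hB
    refine ⟨.univ, 𝒢, hc, hm, fun E hE => ?_⟩
    obtain ⟨C, hC, hCE⟩ := hd E hE
    refine ⟨C, hC, ?_⟩
    have : ∀ᵐ x ∂μ, x ∈ B := by rw [ae_iff]; exact h0
    filter_upwards [this, hCE] with x hx hx' _ using hx' hx
  refine ⟨Bᶜ, hB.1.compl, hD, ?_⟩
  rintro A ⟨hAm, 𝒢, hc, hm, hd⟩
  have hdet : Det μ (A ∩ Bᶜ) := by
    refine ⟨hAm.inter hB.1.compl, 𝒢, hc, hm, fun E hE => ?_⟩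
    obtain ⟨C, hC, hCE⟩ := hd E hE
    refine ⟨C, hC, ?_⟩
    have hCE : ∀ᵐ x ∂μ.restrict Bᶜ, x ∈ A → (x ∈ E ↔ x ∈ C) := (Measure.absolutelyContinuous_smul (μ := μ.restrict Bᶜ) (c := (μ Bᶜ)⁻¹)
      (ENNReal.inv_ne_zero.mpr (measure_ne_top _ _))).ae_le hCE
    rw [ae_restrict_iff' hB.1.compl] at hCE
    filter_upwards [hCE] with x hx hx'
    exact hx hx'.2 hx'.1
  have := hmax _ hdet
  simp only [Measure.smul_apply, smul_eq_mul, Measure.restrict_apply hAm]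
  have h2 : (A ∩ Bᶜ) \ B = A ∩ Bᶜ := by ext; simp
  rw [h2] at this
  rw [this, mul_zero]
lemma integrable_bdd {Ω : Type*} {m0 : MeasurableSpace Ω} {μ : Measure Ω} [IsFiniteMeasure μ]
    {f : Ω → ℝ} (hf : Measurable f) (C : ℝ) (hC : ∀ x, |f x| ≤ C) : Integrable f μ :=
  Integrable.of_bound hf.aestronglyMeasurable C (Filter.Eventually.of_forall hC)

/-- conditionally centred functions bounded by one -/
def Good {Ω : Type*} {m0 : MeasurableSpace Ω} (μ : Measure Ω) (S : MeasurableSpace Ω)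
    (φ : Ω → ℝ) : Prop :=
  Measurable[m0] φ ∧ (∀ x, |φ x| ≤ 1) ∧ μ[φ|S] =ᵐ[μ] 0

lemma stepA {Ω : Type*} (S : MeasurableSpace Ω) [m0 : MeasurableSpace Ω] (μ : Measure Ω) [IsProbabilityMeasure μ]
    (hμ : Nowhere μ) (𝒢 : Set (Set Ω)) (hc : 𝒢.Countable) (hm : ∀ G ∈ 𝒢, MeasurableSet G)
    (hS : S = MeasurableSpace.generateFrom 𝒢)
    (A : Set Ω) (hA : MeasurableSet A) (hA0 : μ A ≠ 0) :
    ∃ φ, Good μ S φ ∧ ¬ (∀ᵐ x ∂μ, x ∈ A → φ x = 0) := by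
  by_contra! hcon
  have hle : S ≤ m0 := hS ▸ MeasurableSpace.generateFrom_le hm
  refine hA0 (hμ A ⟨hA, 𝒢, hc, hm, fun B hB => ?_⟩)
  set b : Ω → ℝ := B.indicator 1 with hb
  have hbm : Measurable b := measurable_one.indicator hB
  have hb01 : ∀ x, 0 ≤ b x ∧ b x ≤ 1 := by
    intro x
    by_cases hx : x ∈ B <;> simp [hb, hx]
  have hbi : Integrable b μ := integrable_bdd hbm 1 fun x => by
    rw [abs_of_nonneg (hb01 x).1]; exact (hb01 x).2
  set c : Ω → ℝ := fun x => max 0 (min 1 ((μ[b|S]) x)) with hcdef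
  have hcm : Measurable[S] c :=
    (@measurable_const _ _ _ S _).max ((@measurable_const _ _ _ S _).min stronglyMeasurable_condExp.measurable)
  have hc01 : ∀ x, 0 ≤ c x ∧ c x ≤ 1 := fun x =>
    ⟨le_max_left _ _, max_le zero_le_one (min_le_left _ _)⟩
  have hci : Integrable c μ := integrable_bdd (hcm.mono hle le_rfl) 1 fun x => by
    rw [abs_of_nonneg (hc01 x).1]; exact (hc01 x).2
  have hcb : c =ᵐ[μ] μ[b|S] := by
    have h0 : 0 ≤ᵐ[μ] μ[b|S] := condExp_nonneg (Filter.Eventually.of_forall fun x => (hb01 x).1)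
    have h1 : μ[b|S] ≤ᵐ[μ] μ[(fun _ => (1:ℝ))|S] :=
      condExp_mono hbi (integrable_const _) (Filter.Eventually.of_forall fun x => (hb01 x).2)
    rw [condExp_const hle] at h1
    filter_upwards [h0, h1] with x h0 h1
    simp only [hcdef, Pi.zero_apply] at *
    rw [min_eq_right h1, max_eq_right h0]
  have hgood : Good μ S (b - c) := by
    refine ⟨hbm.sub (hcm.mono hle le_rfl), fun x => ?_, ?_⟩
    · rw [Pi.sub_apply, abs_le]
      constructor <;> linarith [(hb01 x).1, (hb01 x).2, (hc01 x).1, (hc01 x).2]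
    · have h1 := condExp_sub hbi hci S
      rw [condExp_of_stronglyMeasurable hle hcm.stronglyMeasurable hci] at h1
      filter_upwards [h1, hcb] with x h1 h2
      rw [h1]
      simp [h2]
  have := hcon _ hgood
  refine ⟨{x | c x = 1}, hS ▸ hcm (measurableSet_singleton 1), ?_⟩
  filter_upwards [this] with x hx hxA
  have h := hx hxA
  simp only [Pi.sub_apply, sub_eq_zero] at h
  by_cases hxB : x ∈ B <;> simp [hb, hxB, ← h]

lemma good_union {Ω : Type*} (S : MeasurableSpace Ω) [m0 : MeasurableSpace Ω] (μ : Measure Ω)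
    [IsProbabilityMeasure μ] (hle : S ≤ m0) (U : ℕ → Set Ω)
    (hU : ∀ n, MeasurableSet[S] (U n)) (φ : ℕ → Ω → ℝ) (hφ : ∀ n, Good μ S (φ n))
    (hpos : ∀ n, ∀ᵐ x ∂μ, x ∈ U n → 0 < (μ[φ n ^ 2|S]) x) :
    ∃ ψ, Good μ S ψ ∧ ∀ᵐ x ∂μ, x ∈ (⋃ n, U n) → 0 < (μ[ψ ^ 2|S]) x := by
  classical
  let p : ℕ → Ω → Prop := fun n x => x ∈ U n ∨ ∀ m, x ∉ U m
  have hp : ∀ x, ∃ n, p n x := by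
    intro x
    by_cases h : ∃ n, x ∈ U n
    · obtain ⟨n, hn⟩ := h
      exact ⟨n, Or.inl hn⟩
    · push Not at h
      exact ⟨0, Or.inr h⟩
  have hpm : ∀ n, MeasurableSet[S] {x | p n x} := by
    intro n
    have : {x | p n x} = U n ∪ ⋂ m, (U m)ᶜ := by
      ext x; simp [p]
    rw [this]
    exact (hU n).union (MeasurableSet.iInter fun m => (hU m).compl)
  have hN : Measurable[S] fun x => Nat.find (hp x) := @measurable_find _ S _ _ hp hpm
  let ψ : Ω → ℝ := fun x => φ (Nat.find (hp x)) x
  have hψm : Measurable ψ := Measurable.find (fun n => (hφ n).1) (fun n => hle _ (hpm n)) hp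
  have hψ1 : ∀ x, |ψ x| ≤ 1 := fun x => (hφ _).2.1 x
  let W : ℕ → Set Ω := fun n => {x | Nat.find (hp x) = n}
  have hW : ∀ n, MeasurableSet[S] (W n) := fun n => hN (measurableSet_singleton n)
  have hIntg : ∀ f : Ω → ℝ, Measurable f → (∀ x, |f x| ≤ 1) → Integrable f μ :=
    fun f h1 h2 => integrable_bdd h1 1 h2
  have hsq : ∀ f : Ω → ℝ, (∀ x, |f x| ≤ 1) → ∀ x, |(f ^ 2) x| ≤ 1 := by
    intro f hf x
    rw [Pi.pow_apply, abs_pow]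
    exact pow_le_one₀ (abs_nonneg _) (hf x)
  have key : ∀ (f g : Ω → ℝ), Integrable f μ → Integrable g μ → ∀ n, (∀ x ∈ W n, f x = g x) →
      ∀ᵐ x ∂μ, x ∈ W n → (μ[f|S]) x = (μ[g|S]) x := by
    intro f g hf hg n h
    have h1 : (f - g) =ᵐ[μ.restrict (W n)] 0 := by
      rw [Filter.EventuallyEq, ae_restrict_iff' (hle _ (hW n))]
      exact Filter.Eventually.of_forall fun x hx => by simp [h x hx]
    have h2 := condExp_ae_eq_restrict_zero (hW n) h1
    rw [Filter.EventuallyEq, ae_restrict_iff' (hle _ (hW n))] at h2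
    filter_upwards [h2, condExp_sub hf hg S] with x h2 h3 hx
    have := h2 hx
    rw [h3] at this
    simpa [sub_eq_zero] using this
  have hW1 : ∀ n, ∀ x ∈ W n, ψ x = φ n x := by
    rintro n x rfl
    rfl
  refine ⟨ψ, ⟨hψm, hψ1, ?_⟩, ?_⟩
  · have h1 := ae_all_iff.mpr fun n => key ψ (φ n) (hIntg _ hψm hψ1) (hIntg _ (hφ n).1 (hφ n).2.1) n (hW1 n)
    have h2 := ae_all_iff.mpr fun n => (hφ n).2.2
    filter_upwards [h1, h2] with x h1 h2
    rw [h1 (Nat.find (hp x)) rfl, h2]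
  · have h1 := ae_all_iff.mpr fun n => key (ψ ^ 2) (φ n ^ 2) (hIntg _ (hψm.pow_const 2) (hsq _ hψ1))
      (hIntg _ ((hφ n).1.pow_const 2) (hsq _ (hφ n).2.1)) n (fun x hx => by simp [hW1 n x hx])
    have h2 := ae_all_iff.mpr hpos
    filter_upwards [h1, h2] with x h1 h2 hx
    rw [h1 (Nat.find (hp x)) rfl]
    apply h2
    rcases Nat.find_spec (hp x) with h | h
    · exact h
    · obtain ⟨n, hn⟩ := mem_iUnion.mp hx
      exact absurd hn (h n)

lemma exists_good {Ω : Type*} (S : MeasurableSpace Ω) [m0 : MeasurableSpace Ω] (μ : Measure Ω) [IsProbabilityMeasure μ]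
    (hμ : Nowhere μ) (𝒢 : Set (Set Ω)) (hc : 𝒢.Countable) (hm : ∀ G ∈ 𝒢, MeasurableSet G)
    (hS : S = MeasurableSpace.generateFrom 𝒢) :
    ∃ φ u : Ω → ℝ, Good μ S φ ∧
      Measurable[S] u ∧ (∀ x, 0 ≤ u x ∧ u x ≤ 1) ∧
      u =ᵐ[μ] μ[φ ^ 2|S] ∧ ∀ᵐ x ∂μ, 0 < u x := by
  have hle : S ≤ m0 := hS ▸ MeasurableSpace.generateFrom_le hm
  have hsq : ∀ f : Ω → ℝ, (∀ x, |f x| ≤ 1) → ∀ x, |(f ^ 2) x| ≤ 1 := by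
    intro f hf x
    rw [Pi.pow_apply, abs_pow]
    exact pow_le_one₀ (abs_nonneg _) (hf x)
  have hIntg : ∀ φ, Good μ S φ → Integrable (φ ^ 2) μ := fun φ h =>
    integrable_bdd (h.1.pow_const 2) 1 (hsq _ h.2.1)
  obtain ⟨U, ⟨hUm, φ, hφ, hpos⟩, hmax⟩ := exhaustion μ
    (fun U => MeasurableSet[S] U ∧ ∃ φ, Good μ S φ ∧ ∀ᵐ x ∂μ, x ∈ U → 0 < (μ[φ ^ 2|S]) x)
    ⟨∅, @MeasurableSet.empty _ S, 0, ⟨measurable_zero, by simp, by rw [condExp_zero]⟩, by simp⟩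
    (fun A hA => hle _ hA.1)
    (fun A hA => by
      choose h1 φ h2 h3 using hA
      exact ⟨MeasurableSet.iUnion h1, good_union S μ hle A h1 φ h2 h3⟩)
  have hU0 : μ Uᶜ = 0 := by
    by_contra hne
    obtain ⟨χ, hχ, hχ0⟩ := stepA S μ hμ 𝒢 hc hm hS Uᶜ (hle _ hUm.compl) hne
    apply hχ0
    have hV : MeasurableSet[S] {x | 0 < (μ[χ ^ 2|S]) x} :=
      measurableSet_lt (@measurable_const _ _ _ S _) stronglyMeasurable_condExp.measurable
    have h1 := hmax {x | 0 < (μ[χ ^ 2|S]) x} ⟨hV, χ, hχ, Filter.Eventually.of_forall fun x hx => hx⟩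
    have h2 : ∀ᵐ x ∂μ, x ∈ Uᶜ → (μ[χ ^ 2|S]) x ≤ 0 := by
      have : ∀ᵐ x ∂μ, x ∉ {x | 0 < (μ[χ ^ 2|S]) x} \ U := measure_eq_zero_iff_ae_notMem.mp h1
      filter_upwards [this] with x hx hxU
      by_contra hlt
      exact hx ⟨not_le.mp hlt, hxU⟩
    have h3 : ∫ x in Uᶜ, (χ ^ 2) x ∂μ ≤ 0 := by
      rw [← setIntegral_condExp hle (hIntg χ hχ) hUm.compl]
      apply integral_nonpos_of_ae
      rw [Filter.EventuallyLE, ae_restrict_iff' (hle _ hUm.compl)]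
      exact h2
    have h4 : ∫ x in Uᶜ, (χ ^ 2) x ∂μ = 0 :=
      le_antisymm h3 (integral_nonneg fun x => by simp only [Pi.pow_apply, Pi.zero_apply]; positivity)
    rw [integral_eq_zero_iff_of_nonneg (fun x => by simp only [Pi.pow_apply, Pi.zero_apply]; positivity)
      (hIntg χ hχ).integrableOn, Filter.EventuallyEq, ae_restrict_iff' (hle _ hUm.compl)] at h4
    filter_upwards [h4] with x hx hxU
    simpa using hx hxU
  have hUae : ∀ᵐ x ∂μ, x ∈ U := by rw [ae_iff]; exact hU0
  refine ⟨φ, fun x => max 0 (min 1 ((μ[φ ^ 2|S]) x)), hφ, ?_, fun x =>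
    ⟨le_max_left _ _, max_le zero_le_one (min_le_left _ _)⟩, ?_, ?_⟩
  · exact (@measurable_const _ _ _ S _).max
      ((@measurable_const _ _ _ S _).min stronglyMeasurable_condExp.measurable)
  · have h1 : μ[φ ^ 2|S] ≤ᵐ[μ] μ[(fun _ => (1:ℝ))|S] :=
      condExp_mono (hIntg φ hφ) (integrable_const _)
        (Filter.Eventually.of_forall fun x => (le_abs_self _).trans (hsq φ hφ.2.1 x))
    rw [condExp_const hle] at h1
    filter_upwards [h1, hUae, hpos] with x h1 h2 h3
    rw [min_eq_right h1, max_eq_right (h3 h2).le]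
  · filter_upwards [hUae, hpos] with x h2 h3
    exact lt_max_of_lt_right (lt_min one_pos (h3 h2))
lemma measurable_of_rat {Ω : Type*} (m : MeasurableSpace Ω) (f : Ω → ℝ)
    (h : ∀ a : ℚ, MeasurableSet {x | f x < a}) : Measurable f := by
  have hb : Real.measurableSpace = MeasurableSpace.generateFrom (⋃ a : ℚ, {Iio (a : ℝ)}) := by
    rw [← Real.borel_eq_generateFrom_Iio_rat]
    exact BorelSpace.measurable_eq
  rw [hb]
  apply measurable_generateFrom
  intro t ht
  obtain ⟨a, ha⟩ := mem_iUnion.mp ht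
  rw [mem_singleton_iff] at ha
  subst ha
  exact h a

lemma wf_exists {I β : Type*} [LinearOrder I] [WellFoundedLT I]
    (R : ∀ i : I, ((j : I) → j < i → β) → β → Prop) (h : ∀ i g, ∃ b, R i g b) :
    ∃ Φ : I → β, ∀ i, R i (fun j _ => Φ j) (Φ i) := by
  have wf : WellFounded ((· < ·) : I → I → Prop) := wellFounded_lt
  refine ⟨wf.fix fun i g => (h i g).choose, fun i => ?_⟩
  conv in wf.fix (fun i g => (h i g).choose) i => rw [wf.fix_eq]
  exact (h i _).choose_spec

lemma exists_index : ∃ (I : Type 1) (_ : LinearOrder I), WellFoundedLT I ∧ Nonempty I ∧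
    (∀ i : I, (Iio i).Countable) ∧ ∀ f : ℕ → I, ∃ b, ∀ n, f n < b := by
  refine ⟨Iio (Ordinal.omega 1), inferInstance, inferInstance, ⟨⟨0, Ordinal.omega_pos 1⟩⟩, ?_, ?_⟩
  · rintro ⟨o, ho⟩
    have h1 : (Iio o).Countable := by
      rw [← Cardinal.le_aleph0_iff_set_countable, Cardinal.mk_Iio_ordinal]
      have : o.card < Cardinal.aleph 1 := by
        rw [← Cardinal.lt_ord]
        simpa using ho
      have : o.card ≤ Cardinal.aleph0 := by
        rw [← Order.lt_succ_iff, Cardinal.succ_aleph0]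
        exact this
      have h2 := Cardinal.lift_le.{1}.mpr this
      rw [Cardinal.lift_aleph0] at h2
      exact h2
    refine (h1.preimage (f := Subtype.val) Subtype.val_injective).mono ?_
    intro x hx
    exact hx
  · intro f
    have h := Ordinal.iSup_lt_omega_one (f := fun n => Order.succ (f n).1) (fun n => (Cardinal.isSuccLimit_omega 1).succ_lt (f n).2)
    refine ⟨⟨_, h⟩, fun n => ?_⟩
    show (f n).1 < _
    exact (Order.lt_succ _).trans_le (Ordinal.le_iSup (fun n => Order.succ (f n).1) n)

/-- A chain of conditionally centred functions. -/
structure Chain (I : Type*) [LinearOrder I] {Ω : Type*} {m0 : MeasurableSpace Ω} (μ : Measure Ω) where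
  S : I → MeasurableSpace Ω
  φ : I → Ω → ℝ
  u : I → Ω → ℝ
  mono : ∀ i j, i ≤ j → S i ≤ S j
  le : ∀ i, S i ≤ m0
  meas : ∀ i j, i < j → Measurable[S j] (φ i)
  good : ∀ i, Good μ (S i) (φ i)
  umeas : ∀ i, Measurable[S i] (u i)
  u01 : ∀ i x, 0 ≤ u i x ∧ u i x ≤ 1
  ucond : ∀ i, u i =ᵐ[μ] μ[φ i ^ 2|S i]
  upos : ∀ i, ∀ᵐ x ∂μ, 0 < u i x

lemma exists_chain (I : Type*) [LinearOrder I] [WellFoundedLT I] (hI : ∀ i : I, (Iio i).Countable)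
    {Ω : Type*} {m0 : MeasurableSpace Ω} (μ : Measure Ω)
    [IsProbabilityMeasure μ] (hμ : Nowhere μ) : Nonempty (Chain I μ) := by
  let 𝒢 : ∀ i : I, ((j : I) → j < i → {f : Ω → ℝ // Measurable f}) → Set (Set Ω) :=
    fun i g => range fun p : Iio i × ℚ => {x | (g p.1.1 p.1.2).1 x < (p.2 : ℝ)}
  have hc : ∀ i g, (𝒢 i g).Countable := by
    intro i g
    have := (hI i).to_subtype
    exact countable_range _
  have hm : ∀ i g, ∀ G ∈ 𝒢 i g, MeasurableSet G := by
    rintro i g _ ⟨p, rfl⟩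
    exact measurableSet_lt (g p.1.1 p.1.2).2 measurable_const
  obtain ⟨Φ, hΦ⟩ := wf_exists (I := I) (β := {f : Ω → ℝ // Measurable f})
    (fun i g b => ∃ u : Ω → ℝ, Good μ (MeasurableSpace.generateFrom (𝒢 i g)) b.1 ∧
      Measurable[MeasurableSpace.generateFrom (𝒢 i g)] u ∧ (∀ x, 0 ≤ u x ∧ u x ≤ 1) ∧
      u =ᵐ[μ] μ[b.1 ^ 2|MeasurableSpace.generateFrom (𝒢 i g)] ∧ ∀ᵐ x ∂μ, 0 < u x)
    (fun i g => by
      obtain ⟨φ, u, h⟩ := exists_good _ μ hμ (𝒢 i g) (hc i g) (hm i g) rfl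
      exact ⟨⟨φ, h.1.1⟩, u, h⟩)
  choose u h1 h2 h3 h4 h5 using hΦ
  refine ⟨⟨fun i => MeasurableSpace.generateFrom (𝒢 i fun j _ => Φ j), fun i => (Φ i).1, u,
    ?_, ?_, ?_, h1, h2, h3, h4, h5⟩⟩
  · intro i j hij
    apply MeasurableSpace.generateFrom_mono
    rintro _ ⟨p, rfl⟩
    exact ⟨(⟨p.1.1, lt_of_lt_of_le p.1.2 hij⟩, p.2), rfl⟩
  · intro i
    exact MeasurableSpace.generateFrom_le (hm i fun j _ => Φ j)
  · intro i j hij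
    exact measurable_of_rat _ _ fun a =>
      MeasurableSpace.measurableSet_generateFrom ⟨(⟨i, hij⟩, a), rfl⟩
section chain
variable {I : Type*} [LinearOrder I] {Ω : Type*} {m0 : MeasurableSpace Ω} {μ : Measure Ω}
  [IsProbabilityMeasure μ]

lemma Chain.meas0 (c : Chain I μ) (i : I) : Measurable (c.φ i) := (c.good i).1

lemma Chain.prod_meas (c : Chain I μ) (γ : I) (G : Finset I) (hG : ∀ i ∈ G, i < γ) :
    Measurable[c.S γ] (fun x => ∏ i ∈ G, c.φ i x) :=
  @Finset.measurable_fun_prod _ _ _ _ _ _ (c.S γ) _ G fun i hi => c.meas i γ (hG i hi)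

lemma Chain.prod_meas0 (c : Chain I μ) (G : Finset I) :
    Measurable (fun x => ∏ i ∈ G, c.φ i x) :=
  Finset.measurable_fun_prod G fun i _ => c.meas0 i

lemma Chain.prod_le (c : Chain I μ) (G : Finset I) (x : Ω) : |∏ i ∈ G, c.φ i x| ≤ 1 := by
  rw [Finset.abs_prod]
  exact Finset.prod_le_one (fun _ _ => abs_nonneg _) fun i _ => (c.good i).2.1 x

lemma Chain.int_mul_prod (c : Chain I μ) (G : Finset I) {s : Ω → ℝ} (hs : Integrable s μ) :
    Integrable (fun x => s x * ∏ i ∈ G, c.φ i x) μ :=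
  hs.mul_bdd (c := 1) (c.prod_meas0 G).aestronglyMeasurable (Filter.Eventually.of_forall (c.prod_le G))

lemma Chain.integral_eq_zero (c : Chain I μ) (γ : I) (G : Finset I) (hγ : γ ∈ G)
    (hG : ∀ i ∈ G, i ≤ γ) (s : Ω → ℝ) (hs : Measurable[c.S γ] s) (hi : Integrable s μ) :
    ∫ x, s x * ∏ i ∈ G, c.φ i x ∂μ = 0 := by
  set f : Ω → ℝ := fun x => s x * ∏ i ∈ G.erase γ, c.φ i x with hf
  have hfm : Measurable[c.S γ] f := hs.mul (c.prod_meas γ _ fun i hi =>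
    lt_of_le_of_ne (hG i (Finset.mem_of_mem_erase hi)) (Finset.ne_of_mem_erase hi))
  have heq : (fun x => s x * ∏ i ∈ G, c.φ i x) = f * c.φ γ := by
    ext x
    simp only [hf, Pi.mul_apply]
    rw [← Finset.prod_erase_mul G _ hγ]
    ring
  have hIntg : Integrable (f * c.φ γ) μ := heq ▸ c.int_mul_prod G hi
  have h1 := condExp_mul_of_stronglyMeasurable_left (m := c.S γ) hfm.stronglyMeasurable hIntg
    (integrable_bdd (c.meas0 γ) 1 (c.good γ).2.1)
  rw [heq, ← integral_condExp (c.le γ)]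
  apply integral_eq_zero_of_ae
  filter_upwards [h1, (c.good γ).2.2] with x h1 h2
  rw [h1, Pi.mul_apply, h2]
  simp

lemma Chain.integral_prod_eq_zero (c : Chain I μ) (G : Finset I) (hG : G.Nonempty) :
    ∫ x, ∏ i ∈ G, c.φ i x ∂μ = 0 := by
  have := c.integral_eq_zero (G.max' hG) G (G.max'_mem hG) (fun i hi => G.le_max' i hi)
    (fun _ => 1) (@measurable_const _ _ _ (_) _) (integrable_const _)
  simpa using this

lemma Chain.integral_sq (c : Chain I μ) (γ : I) (G : Finset I) (hG : ∀ i ∈ G, i < γ) :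
    ∫ x, c.φ γ x ^ 2 * ∏ i ∈ G, c.φ i x ∂μ = ∫ x, c.u γ x * ∏ i ∈ G, c.φ i x ∂μ := by
  have h2 : Integrable (c.φ γ ^ 2) μ := integrable_bdd ((c.meas0 γ).pow_const 2) 1 fun x => by
    rw [Pi.pow_apply, abs_pow]
    exact pow_le_one₀ (abs_nonneg _) ((c.good γ).2.1 x)
  have hIntg := c.int_mul_prod G h2
  have h1 := condExp_mul_of_stronglyMeasurable_right (m := c.S γ)
    (c.prod_meas γ G hG).stronglyMeasurable hIntg h2
  change ∫ x, ((c.φ γ ^ 2) * fun x => ∏ i ∈ G, c.φ i x) x ∂μ = _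
  rw [← integral_condExp (c.le γ)]
  apply integral_congr_ae
  filter_upwards [h1, c.ucond γ] with x h1 h2
  rw [h1, Pi.mul_apply, h2]

lemma Chain.eventually_zero (c : Chain I μ) (hb : ∀ f : ℕ → I, ∃ b, ∀ n, f n < b) [Nonempty I]
    (g : Ω → ℝ) (hg : Integrable g μ) :
    ∃ α, ∀ G : Finset I, G.Nonempty → (∀ i ∈ G, α ≤ i) →
      ∫ x, g x * ∏ i ∈ G, c.φ i x ∂μ = 0 := by
  obtain ⟨T, hT⟩ : ∃ T : MeasurableSpace Ω, ∀ A, MeasurableSet[T] A ↔ ∃ i, MeasurableSet[c.S i] A :=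
    ⟨{ MeasurableSet' := fun A => ∃ i, MeasurableSet[c.S i] A
       measurableSet_empty := ⟨Classical.arbitrary I, @MeasurableSet.empty _ (_)⟩
       measurableSet_compl := fun A ⟨i, hi⟩ => ⟨i, hi.compl⟩
       measurableSet_iUnion := fun A hA => by
        choose i hi using hA
        obtain ⟨b, hb⟩ := hb i
        exact ⟨b, @MeasurableSet.iUnion _ _ (_) _ _ fun n => c.mono _ _ (hb n).le _ (hi n)⟩ },
      fun A => Iff.rfl⟩
  have hTle : T ≤ m0 := by
    intro A hA
    obtain ⟨i, hi⟩ := (hT A).mp hA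
    exact c.le i _ hi
  have hST : ∀ i, c.S i ≤ T := fun i A hA => (hT A).mpr ⟨i, hA⟩
  have hhm : Measurable[T] (μ[g|T]) := stronglyMeasurable_condExp.measurable
  have h1 : ∀ n : ℕ, ∃ i, ∀ a : ℚ, Encodable.encode a = n →
      MeasurableSet[c.S i] {x | (μ[g|T]) x < a} := by
    intro n
    by_cases hn : ∃ a : ℚ, Encodable.encode a = n
    · obtain ⟨a, ha⟩ := hn
      obtain ⟨i, hi⟩ := (hT _).mp (hhm (measurableSet_Iio (a := (a : ℝ))))
      refine ⟨i, fun a' ha' => ?_⟩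
      have : a' = a := Encodable.encode_injective (ha'.trans ha.symm)
      rw [this]
      exact hi
    · push Not at hn
      exact ⟨Classical.arbitrary I, fun a ha => absurd ha (hn a)⟩
  choose i hi using h1
  obtain ⟨α, hα⟩ := hb i
  refine ⟨α, fun G hGne hG => ?_⟩
  have hmα : Measurable[c.S α] (μ[g|T]) := measurable_of_rat _ _ fun a =>
    c.mono _ _ (hα _).le _ (hi _ a rfl)
  set γ := G.max' hGne with hγ
  obtain ⟨b, hb⟩ := hb fun _ => γ
  have hpm : Measurable[T] (fun x => ∏ i ∈ G, c.φ i x) :=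
    (c.prod_meas b G fun i hi => (G.le_max' i hi).trans_lt (hb 0)).mono (hST b) le_rfl
  have h2 := condExp_mul_of_stronglyMeasurable_right (m := T)
    hpm.stronglyMeasurable (c.int_mul_prod G hg) hg
  change ∫ x, (g * fun x => ∏ i ∈ G, c.φ i x) x ∂μ = _
  rw [← integral_condExp hTle, integral_congr_ae h2]
  exact c.integral_eq_zero γ G (G.max'_mem hGne) (fun i hi => G.le_max' i hi) _
    (hmα.mono (c.mono _ _ (hG _ (G.max'_mem hGne))) le_rfl) integrable_condExp

end chain
lemma exists_eta {Ω : Type*} {m0 : MeasurableSpace Ω} {μ : Measure Ω} [IsProbabilityMeasure μ]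
    (u : Ω → ℝ) (hu : Measurable u) (hpos : ∀ᵐ x ∂μ, 0 < u x) :
    ∃ η : ℝ, 0 < η ∧ ∫ x, {x | u x < η}.indicator (fun _ => (1 : ℝ)) x ∂μ ≤ 1 / 4 := by
  let s : ℕ → Set Ω := fun n => {x | u x < 1 / ((n : ℝ) + 1)}
  have hs : ∀ n, MeasurableSet (s n) := fun n => measurableSet_lt hu measurable_const
  have hanti : Antitone s := by
    intro n m hnm x hx
    have hx' : u x < 1 / ((m : ℝ) + 1) := hx
    change u x < 1 / ((n : ℝ) + 1)
    have hnm' : (n : ℝ) ≤ m := by exact_mod_cast hnm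
    exact hx'.trans_le (one_div_le_one_div_of_le (by positivity) (by linarith))
  have h0 : μ (⋂ n, s n) = 0 := by
    refine measure_mono_null ?_ (ae_iff.mp hpos)
    intro x hx
    simp only [mem_iInter] at hx
    simp only [not_lt]
    change u x ≤ 0
    by_contra hlt
    push Not at hlt
    obtain ⟨n, hn⟩ := exists_nat_one_div_lt hlt
    exact lt_asymm hn (hx n)
  have ht := tendsto_measure_iInter_atTop (fun n => (hs n).nullMeasurableSet) hanti
    ⟨0, measure_ne_top μ _⟩
  rw [h0] at ht
  have : ∀ᶠ n in Filter.atTop, μ (s n) < ENNReal.ofReal (1 / 4) :=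
    (tendsto_order.1 ht).2 _ (by simp)
  obtain ⟨n, hn⟩ := this.exists
  refine ⟨1 / ((n : ℝ) + 1), by positivity, ?_⟩
  change ∫ x, (s n).indicator (fun _ => (1 : ℝ)) x ∂μ ≤ 1 / 4
  rw [integral_indicator_const _ (hs n)]
  simp only [smul_eq_mul, mul_one]
  exact ENNReal.toReal_le_of_le_ofReal (by norm_num) hn.le

section pair
variable {I : Type*} [LinearOrder I] {X Y : Type*} {mX : MeasurableSpace X} {mY : MeasurableSpace Y}
  {μ : Measure X} {ν : Measure Y} [IsProbabilityMeasure μ] [IsProbabilityMeasure ν]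
  (c : Chain I μ) (d : Chain I ν)

/-- Riesz product density -/
def rz (F : Finset I) (z : X × Y) : ℝ := ∏ i ∈ F, (1 + c.φ i z.1 * d.φ i z.2)

lemma rz_meas (F : Finset I) : Measurable (rz c d F) :=
  Finset.measurable_fun_prod F fun i _ => measurable_const.add
    (((c.meas0 i).comp measurable_fst).mul ((d.meas0 i).comp measurable_snd))

lemma abs_phi_le (i : I) (z : X × Y) : |c.φ i z.1 * d.φ i z.2| ≤ 1 := by
  rw [abs_mul]
  exact mul_le_one₀ ((c.good i).2.1 _) (abs_nonneg _) ((d.good i).2.1 _)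

lemma rz_nonneg (F : Finset I) (z : X × Y) : 0 ≤ rz c d F z :=
  Finset.prod_nonneg fun i _ => by linarith [(abs_le.mp (abs_phi_le c d i z)).1]

lemma rz_le (F : Finset I) (z : X × Y) : |rz c d F z| ≤ 2 ^ F.card := by
  rw [rz, Finset.abs_prod]
  rw [← Finset.prod_const]
  refine Finset.prod_le_prod (fun _ _ => abs_nonneg _) fun i _ => ?_
  have := abs_le.mp (abs_phi_le c d i z)
  rw [abs_le]
  constructor <;> linarith

lemma rz_int_mul (F : Finset I) {f : X × Y → ℝ} (hf : Integrable f (μ.prod ν)) :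
    Integrable (fun z => f z * rz c d F z) (μ.prod ν) :=
  hf.mul_bdd (c := 2 ^ F.card) (rz_meas c d F).aestronglyMeasurable
    (Filter.Eventually.of_forall (rz_le c d F))

lemma rz_expand (F : Finset I) (a : X → ℝ) (b : Y → ℝ) (ha : Integrable a μ) (hb : Integrable b ν) :
    ∫ z, a z.1 * b z.2 * rz c d F z ∂μ.prod ν =
      ∑ G ∈ F.powerset, (∫ x, a x * ∏ i ∈ G, c.φ i x ∂μ) * ∫ y, b y * ∏ i ∈ G, d.φ i y ∂ν := by
  have h1 : ∀ z : X × Y, a z.1 * b z.2 * rz c d F z = ∑ G ∈ F.powerset,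
      (a z.1 * ∏ i ∈ G, c.φ i z.1) * (b z.2 * ∏ i ∈ G, d.φ i z.2) := by
    intro z
    rw [rz, Finset.prod_one_add, Finset.mul_sum]
    refine Finset.sum_congr rfl fun G _ => ?_
    rw [Finset.prod_mul_distrib]
    ring
  simp_rw [h1]
  rw [integral_finsetSum]
  · refine Finset.sum_congr rfl fun G _ => ?_
    exact integral_prod_mul (fun x => a x * ∏ i ∈ G, c.φ i x) (fun y => b y * ∏ i ∈ G, d.φ i y)
  · intro G _
    exact (c.int_mul_prod G ha).mul_prod (d.int_mul_prod G hb)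

lemma rz_fst (F : Finset I) (a : X → ℝ) (ha : Integrable a μ) :
    ∫ z, a z.1 * rz c d F z ∂μ.prod ν = ∫ x, a x ∂μ := by
  have := rz_expand c d F a (fun _ => 1) ha (integrable_const _)
  simp only [mul_one, one_mul] at this
  rw [this, Finset.sum_eq_single ∅]
  · simp
  · intro G _ hG
    rw [d.integral_prod_eq_zero G (Finset.nonempty_iff_ne_empty.mpr hG), mul_zero]
  · simp

lemma rz_snd (F : Finset I) (b : Y → ℝ) (hb : Integrable b ν) :
    ∫ z, b z.2 * rz c d F z ∂μ.prod ν = ∫ y, b y ∂ν := by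
  have := rz_expand c d F (fun _ => 1) b (integrable_const _) hb
  simp only [one_mul] at this
  rw [this, Finset.sum_eq_single ∅]
  · simp
  · intro G _ hG
    rw [c.integral_prod_eq_zero G (Finset.nonempty_iff_ne_empty.mpr hG), zero_mul]
  · simp

lemma rz_one (F : Finset I) : ∫ z, rz c d F z ∂μ.prod ν = 1 := by
  have := rz_fst c d F (fun _ => 1) (integrable_const _)
  simpa using this

lemma Chain.int_phi (c : Chain I μ) (γ : I) : Integrable (c.φ γ) μ :=
  integrable_bdd (c.meas0 γ) 1 (c.good γ).2.1

lemma Chain.umeas0 (c : Chain I μ) (γ : I) : Measurable (c.u γ) := (c.umeas γ).mono (c.le γ) le_rfl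

lemma Chain.int_u (c : Chain I μ) (γ : I) : Integrable (c.u γ) μ :=
  integrable_bdd (c.umeas0 γ) 1 fun x => by
    rw [abs_of_nonneg (c.u01 γ x).1]; exact (c.u01 γ x).2

lemma Chain.phi_prod (c : Chain I μ) (γ : I) (G : Finset I) (hG : ∀ i ∈ G, i < γ) :
    ∫ x, c.φ γ x * ∏ i ∈ insert γ G, c.φ i x ∂μ = ∫ x, c.u γ x * ∏ i ∈ G, c.φ i x ∂μ := by
  rw [← c.integral_sq γ G hG]
  congr 1
  ext x
  rw [Finset.prod_insert (fun h => lt_irrefl _ (hG _ h))]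
  ring

/-- vanishing of the remaining terms -/
lemma Chain.phi_prod_zero (c : Chain I μ) (γ : I) (G : Finset I)
    (hG : γ ∉ G ∨ ∃ i ∈ G, γ < i) : ∫ x, c.φ γ x * ∏ i ∈ G, c.φ i x ∂μ = 0 := by
  by_cases hlt : ∃ i ∈ G, γ < i
  · obtain ⟨i, hi, hγi⟩ := hlt
    have hne : G.Nonempty := ⟨i, hi⟩
    exact c.integral_eq_zero (G.max' hne) G (G.max'_mem hne) (fun i hi => G.le_max' i hi) _
      (c.meas _ _ (hγi.trans_le (G.le_max' i hi))) (c.int_phi γ)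
  · have hγ : γ ∉ G := hG.resolve_right hlt
    push Not at hlt
    have := c.integral_prod_eq_zero (insert γ G) (Finset.insert_nonempty _ _)
    simpa only [Finset.prod_insert hγ] using this

lemma rz_phi (F : Finset I) (γ : I) (hγ : γ ∈ F) :
    ∫ z, c.φ γ z.1 * d.φ γ z.2 * rz c d F z ∂μ.prod ν =
      ∫ z, c.u γ z.1 * d.u γ z.2 * rz c d (F.filter (· < γ)) z ∂μ.prod ν := by
  rw [rz_expand c d F _ _ (c.int_phi γ) (d.int_phi γ), rz_expand c d _ _ _ (c.int_u γ) (d.int_u γ)]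
  symm
  have hlt : ∀ G ∈ (F.filter (· < γ)).powerset, ∀ i ∈ G, i < γ := by
    intro G hG i hi
    exact (Finset.mem_filter.mp (Finset.mem_powerset.mp hG hi)).2
  refine Finset.sum_of_injOn (fun G => insert γ G) ?_ ?_ ?_ ?_
  · intro G hG G' hG' h
    have h1 : γ ∉ G := fun h => lt_irrefl _ (hlt G hG _ h)
    have h2 : γ ∉ G' := fun h => lt_irrefl _ (hlt G' hG' _ h)
    have h' : insert γ G = insert γ G' := h
    rw [← Finset.erase_insert h1, h', Finset.erase_insert h2]
  · intro G hG
    simp only [Finset.coe_powerset, mem_preimage, mem_powerset_iff, Finset.coe_subset] at *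
    exact Finset.insert_subset hγ (hG.trans (Finset.filter_subset _ _))
  · intro G hG hnot
    have : γ ∉ G ∨ ∃ i ∈ G, γ < i := by
      by_contra! hcon
      apply hnot
      refine ⟨G.erase γ, ?_, Finset.insert_erase hcon.1⟩
      simp only [Finset.coe_powerset, mem_preimage, mem_powerset_iff, Finset.coe_subset]
      intro i hi
      refine Finset.mem_filter.mpr ⟨Finset.mem_powerset.mp hG (Finset.mem_of_mem_erase hi), ?_⟩
      exact lt_of_le_of_ne (hcon.2 i (Finset.mem_of_mem_erase hi)) (Finset.ne_of_mem_erase hi)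
    rw [c.phi_prod_zero γ G this, zero_mul]
  · intro G hG
    rw [c.phi_prod γ G (hlt G hG), d.phi_prod γ G (hlt G hG)]

lemma rz_lower (γ : I) : ∃ δ : ℝ, 0 < δ ∧ ∀ F : Finset I, γ ∈ F →
    δ ≤ ∫ z, c.φ γ z.1 * d.φ γ z.2 * rz c d F z ∂μ.prod ν := by
  obtain ⟨η, hη, hη'⟩ := exists_eta (c.u γ) (c.umeas0 γ) (c.upos γ)
  obtain ⟨θ, hθ, hθ'⟩ := exists_eta (d.u γ) (d.umeas0 γ) (d.upos γ)
  set a : X → ℝ := {x | c.u γ x < η}.indicator (fun _ => (1 : ℝ)) with ha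
  set b : Y → ℝ := {x | d.u γ x < θ}.indicator (fun _ => (1 : ℝ)) with hb
  have hai : Integrable a μ := (integrable_const _).indicator
    (measurableSet_lt (c.umeas0 γ) measurable_const)
  have hbi : Integrable b ν := (integrable_const _).indicator
    (measurableSet_lt (d.umeas0 γ) measurable_const)
  refine ⟨η * θ / 2, by positivity, fun F hF => ?_⟩
  rw [rz_phi c d F γ hF]
  set F' := F.filter (· < γ)
  have hIntg1 : Integrable (fun z => rz c d F' z) (μ.prod ν) := by
    simpa using rz_int_mul c d F' (integrable_const (1 : ℝ))
  have hIntg2 := rz_int_mul c d F' (hai.comp_fst ν)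
  have hIntg3 := rz_int_mul c d F' (hbi.comp_snd μ)
  have h1 : ∫ z, (η * θ) * (rz c d F' z - a z.1 * rz c d F' z - b z.2 * rz c d F' z) ∂μ.prod ν ≤
      ∫ z, c.u γ z.1 * d.u γ z.2 * rz c d F' z ∂μ.prod ν := by
    refine integral_mono (((hIntg1.sub hIntg2).sub hIntg3).const_mul _)
      (rz_int_mul c d F' ((c.int_u γ).mul_prod (d.int_u γ))) fun z => ?_
    have hr := rz_nonneg c d F' z
    have hu := (c.u01 γ z.1).1
    have hv := (d.u01 γ z.2).1
    have key : η * θ * (1 - a z.1 - b z.2) ≤ c.u γ z.1 * d.u γ z.2 := by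
      by_cases h1 : c.u γ z.1 < η
      · have : a z.1 = 1 := by simp [ha, h1]
        have hb0 : 0 ≤ b z.2 := indicator_nonneg (fun _ _ => zero_le_one) _
        rw [this]
        have : 0 ≤ η * θ * b z.2 := by positivity
        have := mul_nonneg hu hv
        linarith
      · have : a z.1 = 0 := by simp [ha, h1]
        rw [this]
        by_cases h2 : d.u γ z.2 < θ
        · have : b z.2 = 1 := by simp [hb, h2]
          rw [this]
          have := mul_nonneg hu hv
          linarith
        · have : b z.2 = 0 := by simp [hb, h2]
          rw [this]
          push Not at h1 h2
          have := mul_le_mul h1 h2 hθ.le hu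
          linarith
    have := mul_le_mul_of_nonneg_right key hr
    dsimp only
    linarith
  refine le_trans ?_ h1
  have hIntg12 : Integrable (fun z => rz c d F' z - a z.1 * rz c d F' z) (μ.prod ν) :=
    hIntg1.sub hIntg2
  rw [integral_const_mul, integral_sub hIntg12 hIntg3, integral_sub hIntg1 hIntg2,
    rz_one, rz_fst c d F' a hai, rz_snd c d F' b hbi]
  have : 0 < η * θ := by positivity
  nlinarith

lemma rz_limit (hb : ∀ f : ℕ → I, ∃ b, ∀ n, f n < b) [Nonempty I] (a : X → ℝ) (b : Y → ℝ)
    (ha : Integrable a μ) (hbi : Integrable b ν) :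
    ∃ α, ∀ F : Finset I, (∀ i ∈ F, α ≤ i) →
      ∫ z, a z.1 * b z.2 * rz c d F z ∂μ.prod ν = ∫ z, a z.1 * b z.2 ∂μ.prod ν := by
  obtain ⟨α, hα⟩ := c.eventually_zero hb a ha
  refine ⟨α, fun F hF => ?_⟩
  rw [rz_expand c d F a b ha hbi, integral_prod_mul a b, Finset.sum_eq_single ∅]
  · simp
  · intro G hG hne
    rw [hα G (Finset.nonempty_iff_ne_empty.mpr hne)
      fun i hi => hF i (Finset.mem_powerset.mp hG hi), zero_mul]
  · simp

end pair
lemma rmk {X : Type*} [TopologicalSpace X] [CompactSpace X] [T2Space X]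
    (Λ : C(X, ℝ) → ℝ) (hadd : ∀ f g, Λ (f + g) = Λ f + Λ g) (hsmul : ∀ (r : ℝ) f, Λ (r • f) = r * Λ f)
    (hmono : ∀ f g : C(X, ℝ), (∀ x, f x ≤ g x) → Λ f ≤ Λ g) (hone : Λ 1 = 1) :
    ∃ ν : RadonProb X, ∀ f : C(X, ℝ), ∫ x, f x ∂ν.1 = Λ f := by
  let _ : MeasurableSpace X := borel X
  have _ : BorelSpace X := ⟨rfl⟩
  let Λ' : CompactlySupportedContinuousMap X ℝ →ₚ[ℝ] ℝ :=
  { toFun g := Λ g.toContinuousMap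
    map_add' g g' := hadd _ _
    map_smul' c g := hsmul _ _
    monotone' g g' hgg' := hmono _ _ hgg' }
  have hIntg : ∀ f : C(X, ℝ), ∫ x, f x ∂(RealRMK.rieszMeasure Λ') = Λ f := by
    intro f
    let g' : CompactlySupportedContinuousMap X ℝ :=
    { toFun := f
      hasCompactSupport' := HasCompactSupport.of_compactSpace _ }
    exact RealRMK.integral_rieszMeasure Λ' g'
  refine ⟨⟨RealRMK.rieszMeasure Λ', ?_, inferInstance⟩, hIntg⟩
  have h1 := hIntg 1
  rw [hone] at h1
  simp only [ContinuousMap.one_apply, integral_const, smul_eq_mul, mul_one] at h1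
  constructor
  rw [measureReal_def, ENNReal.toReal_eq_one_iff] at h1
  exact h1

section topo
variable {K L : Type*} [TopologicalSpace K] [TopologicalSpace L]

/-- elementary tensor -/
def tens (p : C(K, ℝ)) (q : C(L, ℝ)) : C(K × L, ℝ) := ⟨fun z => p z.1 * q z.2, by fun_prop⟩

lemma sw [CompactSpace K] [CompactSpace L] [T2Space K] [T2Space L] (P : C(K × L, ℝ) → Prop)
    (ht : ∀ p q, P (tens p q)) (hadd : ∀ f g, P f → P g → P (f + g))
    (hsmul : ∀ (r : ℝ) f, P f → P (r • f))
    (hlim : ∀ f, (∀ ε > 0, ∃ g, P g ∧ ‖g - f‖ < ε) → P f) (f : C(K × L, ℝ)) : P f := by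
  let M : Submonoid C(K × L, ℝ) :=
  { carrier := {f | ∃ p q, f = tens p q}
    one_mem' := ⟨1, 1, by ext; simp [tens]⟩
    mul_mem' := by
      rintro _ _ ⟨p, q, rfl⟩ ⟨p', q', rfl⟩
      refine ⟨p * p', q * q', ?_⟩
      ext z
      simp [tens]
      ring }
  have hP : ∀ g ∈ Algebra.adjoin ℝ (M : Set C(K × L, ℝ)), P g := by
    intro g hg
    rw [← Subalgebra.mem_toSubmodule, Algebra.adjoin_eq_span, Submonoid.closure_eq] at hg
    induction hg using Submodule.span_induction with
    | mem x hx => obtain ⟨p, q, rfl⟩ := hx; exact ht p q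
    | zero =>
      have : (0 : C(K × L, ℝ)) = tens 0 0 := by ext; simp [tens]
      rw [this]; exact ht _ _
    | add x y _ _ hx hy => exact hadd _ _ hx hy
    | smul r x _ hx => exact hsmul _ _ hx
  have hsep : (Algebra.adjoin ℝ (M : Set C(K × L, ℝ))).SeparatesPoints := by
    intro z w hzw
    have key : ∀ p : C(K, ℝ), ∀ q : C(L, ℝ), p z.1 * q z.2 ≠ p w.1 * q w.2 →
      ∃ f ∈ (fun f : C(K × L, ℝ) => (f : K × L → ℝ)) '' (Algebra.adjoin ℝ (M : Set C(K × L, ℝ)) : Set C(K × L, ℝ)), f z ≠ f w := by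
      intro p q h
      exact ⟨_, ⟨tens p q, Algebra.subset_adjoin ⟨p, q, rfl⟩, rfl⟩, h⟩
    by_cases h1 : z.1 = w.1
    · have h2 : z.2 ≠ w.2 := fun h => hzw (Prod.ext h1 h)
      obtain ⟨g, hg0, hg1, -⟩ := exists_continuous_zero_one_of_isClosed
        (isClosed_singleton (x := z.2)) (isClosed_singleton (x := w.2)) (by simpa using h2)
      refine key 1 g ?_
      rw [hg0 rfl, hg1 rfl]; simp
    · obtain ⟨g, hg0, hg1, -⟩ := exists_continuous_zero_one_of_isClosed
        (isClosed_singleton (x := z.1)) (isClosed_singleton (x := w.1)) (by simpa using h1)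
      refine key g 1 ?_
      rw [hg0 rfl, hg1 rfl]; simp
  refine hlim f fun ε hε => ?_
  obtain ⟨g, hg⟩ := ContinuousMap.exists_mem_subalgebra_near_continuousMap_of_separatesPoints
    _ hsep f ε hε
  exact ⟨g, hP _ g.2, hg⟩

lemma exists_cont [CompactSpace K] [T2Space K] [MeasurableSpace K] [BorelSpace K] {μ : Measure K}
    [IsProbabilityMeasure μ] [μ.Regular] (φ : K → ℝ) (hφ : Measurable φ) (h1 : ∀ x, |φ x| ≤ 1)
    (ε : ℝ) (hε : 0 < ε) :
    ∃ p : C(K, ℝ), (∀ x, |p x| ≤ 1) ∧ ∫ x, |φ x - p x| ∂μ ≤ ε := by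
  have hi := integrable_bdd (μ := μ) hφ 1 h1
  obtain ⟨g, -, hg, hgc, hgi⟩ := hi.exists_hasCompactSupport_integral_sub_le hε
  have hclip : ∀ x, |max (-1) (min 1 (g x))| ≤ 1 := by
    intro x
    rw [abs_le]
    exact ⟨le_max_left _ _, max_le (by norm_num) (min_le_left _ _)⟩
  refine ⟨⟨fun x => max (-1) (min 1 (g x)), by fun_prop⟩, hclip, le_trans ?_ hg⟩
  have hm : Measurable (fun x => max (-1) (min 1 (g x))) := by
    have := hgc.measurable
    fun_prop
  refine integral_mono (hi.sub (integrable_bdd hm 1 hclip)).abs (hi.sub hgi).norm fun x => ?_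
  have hx := abs_le.mp (h1 x)
  simp only [ContinuousMap.coe_mk, Real.norm_eq_abs]
  rcases le_total 1 (g x) with h | h
  · rw [min_eq_left h, max_eq_right (by norm_num), abs_of_nonpos (by linarith), abs_of_nonpos (by linarith)]
    linarith
  · rw [min_eq_right h]
    rcases le_total (-1) (g x) with h' | h'
    · rw [max_eq_right h']
    · rw [max_eq_left h', abs_of_nonneg (by linarith), abs_of_nonneg (by linarith)]
      linarith

end topo

section pair2
variable {I : Type*} [LinearOrder I] {X Y : Type*} {mX : MeasurableSpace X} {mY : MeasurableSpace Y}
  {μ : Measure X} {ν : Measure Y} [IsProbabilityMeasure μ] [IsProbabilityMeasure ν]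
  (c : Chain I μ) (d : Chain I ν)

lemma rz_bound (F : Finset I) (f : X × Y → ℝ) (hf : Measurable f) (C : ℝ) (hC : ∀ z, |f z| ≤ C) :
    |∫ z, f z * rz c d F z ∂μ.prod ν| ≤ C := by
  have hi := rz_int_mul c d F (integrable_bdd (μ := μ.prod ν) hf C hC)
  have hr : Integrable (fun z => rz c d F z) (μ.prod ν) := by
    simpa using rz_int_mul c d F (integrable_const (1 : ℝ))
  calc |∫ z, f z * rz c d F z ∂μ.prod ν| ≤ ∫ z, |f z * rz c d F z| ∂μ.prod ν :=
        abs_integral_le_integral_abs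
    _ ≤ ∫ z, C * rz c d F z ∂μ.prod ν := by
        refine integral_mono hi.abs (hr.const_mul C) fun z => ?_
        dsimp only
        rw [abs_mul, abs_of_nonneg (rz_nonneg c d F z)]
        exact mul_le_mul_of_nonneg_right (hC z) (rz_nonneg c d F z)
    _ = C := by rw [integral_const_mul, rz_one, mul_one]

end pair2

section pair3
variable {I : Type*} [LinearOrder I] {K L : Type*} [TopologicalSpace K] [TopologicalSpace L]
  [CompactSpace K] [CompactSpace L] [T2Space K] [T2Space L]
  [MeasurableSpace K] [MeasurableSpace L] [BorelSpace K] [BorelSpace L]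
  {μ : Measure K} {ν : Measure L} [IsProbabilityMeasure μ] [IsProbabilityMeasure ν]
  (c : Chain I μ) (d : Chain I ν)

lemma cont_abs_le (f : C(K × L, ℝ)) (z : K × L) : |f z| ≤ ‖f‖ := f.norm_coe_le_norm z

lemma int_cont (p : C(K, ℝ)) : Integrable p μ :=
  integrable_bdd p.continuous.measurable ‖p‖ p.norm_coe_le_norm

lemma cont_measurable (f : C(K × L, ℝ)) : Measurable f := by
  refine sw (fun f => Measurable f) ?_ ?_ ?_ ?_ f
  · intro p q
    exact (p.continuous.measurable.comp measurable_fst).mul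
      (q.continuous.measurable.comp measurable_snd)
  · intro f g hf hg
    exact hf.add hg
  · intro r f hf
    exact hf.const_smul r
  · intro f h
    choose g hg hgf using fun n : ℕ => h (1 / ((n : ℝ) + 1)) (by positivity)
    have ht : Filter.Tendsto g Filter.atTop (nhds f) := by
      rw [tendsto_iff_norm_sub_tendsto_zero]
      exact squeeze_zero (fun _ => norm_nonneg _) (fun n => (hgf n).le)
        tendsto_one_div_add_atTop_nhds_zero_nat
    refine measurable_of_tendsto_metrizable hg ?_
    rw [tendsto_pi_nhds]
    intro z
    exact ((continuous_eval_const z : Continuous fun g : C(K × L, ℝ) => g z).tendsto f).comp ht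

lemma int_cont2 (f : C(K × L, ℝ)) : Integrable f (μ.prod ν) :=
  integrable_bdd (cont_measurable f) ‖f‖ (cont_abs_le f)

lemma cont_limit (hb : ∀ f : ℕ → I, ∃ b, ∀ n, f n < b) [Nonempty I] (f : C(K × L, ℝ)) :
    ∃ α, ∀ F : Finset I, (∀ i ∈ F, α ≤ i) →
      ∫ z, f z * rz c d F z ∂μ.prod ν = ∫ z, f z ∂μ.prod ν := by
  refine sw (fun f => ∃ α, ∀ F : Finset I, (∀ i ∈ F, α ≤ i) →
      ∫ z, f z * rz c d F z ∂μ.prod ν = ∫ z, f z ∂μ.prod ν) ?_ ?_ ?_ ?_ f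
  · intro p q
    exact rz_limit c d hb p q (int_cont p) (int_cont q)
  · rintro f g ⟨α, hα⟩ ⟨β, hβ⟩
    refine ⟨max α β, fun F hF => ?_⟩
    simp only [ContinuousMap.add_apply, add_mul]
    rw [integral_add (rz_int_mul c d F (int_cont2 f)) (rz_int_mul c d F (int_cont2 g)),
      integral_add (int_cont2 f) (int_cont2 g), hα F fun i hi => (le_max_left _ _).trans (hF i hi),
      hβ F fun i hi => (le_max_right _ _).trans (hF i hi)]
  · rintro r f ⟨α, hα⟩
    refine ⟨α, fun F hF => ?_⟩
    simp only [ContinuousMap.smul_apply, smul_eq_mul, mul_assoc]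
    rw [integral_const_mul, integral_const_mul, hα F hF]
  · intro f h
    choose g hg hgf using fun n : ℕ => h (1 / ((n : ℝ) + 1)) (by positivity)
    choose a ha using hg
    obtain ⟨b, hb'⟩ := hb a
    refine ⟨b, fun F hF => ?_⟩
    have hle : ∀ n : ℕ, |∫ z, f z * rz c d F z ∂μ.prod ν - ∫ z, f z ∂μ.prod ν| ≤
        2 * (1 / ((n : ℝ) + 1)) := by
      intro n
      have h1 := rz_bound c d F (g n - f : C(K × L, ℝ)) (cont_measurable _) _ (cont_abs_le _)
      have h2 := rz_bound c d ∅ (g n - f : C(K × L, ℝ)) (cont_measurable _) _ (cont_abs_le _)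
      have h3 := ha n F fun i hi => (hb' n).le.trans (hF i hi)
      simp only [rz, Finset.prod_empty, mul_one] at h2
      simp only [ContinuousMap.sub_apply, sub_mul] at h1 h2
      rw [integral_sub (rz_int_mul c d F (int_cont2 (g n))) (rz_int_mul c d F (int_cont2 f)), h3] at h1
      rw [integral_sub (int_cont2 (g n)) (int_cont2 f)] at h2
      have h4 := hgf n
      rw [abs_le] at h1 h2 ⊢
      constructor <;> linarith
    have ht : Filter.Tendsto (fun n : ℕ => 2 * (1 / ((n : ℝ) + 1))) Filter.atTop (nhds (2 * 0)) :=
      tendsto_one_div_add_atTop_nhds_zero_nat.const_mul 2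
    rw [mul_zero] at ht
    have := ge_of_tendsto' ht hle
    exact sub_eq_zero.mp (abs_eq_zero.mp (le_antisymm this (abs_nonneg _)))

lemma exists_pq [μ.Regular] [ν.Regular] (γ : I) : ∃ (δ : ℝ) (p : C(K, ℝ)) (q : C(L, ℝ)), 0 < δ ∧
    (∀ F : Finset I, γ ∈ F → 3 * δ / 4 ≤ ∫ z, tens p q z * rz c d F z ∂μ.prod ν) ∧
    ∫ z, tens p q z ∂μ.prod ν ≤ δ / 8 := by
  obtain ⟨δ, hδ, hF⟩ := rz_lower c d γ
  obtain ⟨p, hp, hp'⟩ := exists_cont (μ := μ) (c.φ γ) (c.meas0 γ) (c.good γ).2.1 (δ / 8) (by positivity)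
  obtain ⟨q, hq, hq'⟩ := exists_cont (μ := ν) (d.φ γ) (d.meas0 γ) (d.good γ).2.1 (δ / 8) (by positivity)
  have hpi : Integrable (fun x => |c.φ γ x - p x|) μ := ((c.int_phi γ).sub (int_cont p)).abs
  have hqi : Integrable (fun x => |d.φ γ x - q x|) ν := ((d.int_phi γ).sub (int_cont q)).abs
  refine ⟨δ, p, q, hδ, fun F hγ => ?_, ?_⟩
  · have h0 := hF F hγ
    have i1 := rz_int_mul c d F ((c.int_phi γ).mul_prod (d.int_phi γ))
    have i2 := rz_int_mul c d F (hpi.comp_fst ν)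
    have i3 := rz_int_mul c d F (hqi.comp_snd μ)
    have i4 := rz_int_mul c d F (int_cont2 (μ := μ) (ν := ν) (tens p q))
    have hle : ∫ z, c.φ γ z.1 * d.φ γ z.2 * rz c d F z ∂μ.prod ν ≤
        ∫ z, (tens p q z * rz c d F z + (|c.φ γ z.1 - p z.1| * rz c d F z +
          |d.φ γ z.2 - q z.2| * rz c d F z)) ∂μ.prod ν := by
      refine integral_mono i1 (i4.add (i2.add i3)) fun z => ?_
      have key : c.φ γ z.1 * d.φ γ z.2 ≤ p z.1 * q z.2 + (|c.φ γ z.1 - p z.1| +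
          |d.φ γ z.2 - q z.2|) := by
        have e1 : (c.φ γ z.1 - p z.1) * d.φ γ z.2 ≤ |c.φ γ z.1 - p z.1| := by
          refine (le_abs_self _).trans ?_
          rw [abs_mul]
          exact mul_le_of_le_one_right (abs_nonneg _) ((d.good γ).2.1 _)
        have e2 : p z.1 * (d.φ γ z.2 - q z.2) ≤ |d.φ γ z.2 - q z.2| := by
          refine (le_abs_self _).trans ?_
          rw [abs_mul]
          exact mul_le_of_le_one_left (abs_nonneg _) (hp _)
        linarith
      have := mul_le_mul_of_nonneg_right key (rz_nonneg c d F z)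
      dsimp only [tens, ContinuousMap.coe_mk]
      linarith
    have i23 : Integrable (fun z : K × L => |c.φ γ z.1 - p z.1| * rz c d F z +
          |d.φ γ z.2 - q z.2| * rz c d F z) (μ.prod ν) := i2.add i3
    rw [integral_add i4 i23, integral_add i2 i3,
      rz_fst c d F _ hpi, rz_snd c d F _ hqi] at hle
    linarith
  · have e : ∫ z, tens p q z ∂μ.prod ν = (∫ x, p x ∂μ) * ∫ y, q y ∂ν := integral_prod_mul _ _
    rw [e]
    have h0 : ∫ x, c.φ γ x ∂μ = 0 := by
      have := c.integral_prod_eq_zero {γ} (Finset.singleton_nonempty _)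
      simpa using this
    have h1 : |∫ x, p x ∂μ| ≤ δ / 8 := by
      have := (abs_integral_le_integral_abs (f := fun x => c.φ γ x - p x) (μ := μ)).trans hp'
      rw [integral_sub (c.int_phi γ) (int_cont p), h0, zero_sub, abs_neg] at this
      exact this
    have h2 : |∫ y, q y ∂ν| ≤ 1 := by
      have := norm_integral_le_of_norm_le_const (μ := ν) (f := q) (C := 1)
        (Filter.Eventually.of_forall hq)
      simpa using this
    refine (le_abs_self _).trans ?_
    rw [abs_mul]
    calc _ ≤ δ / 8 * 1 := mul_le_mul h1 h2 (abs_nonneg _) (by positivity)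
      _ = _ := mul_one _

/-- the measure obtained as a limit of Riesz products over indices above `α` -/
lemma exists_lim (α : I) : ∃ ρ : RadonProb (K × L),
    (∀ (f : C(K × L, ℝ)) (t : ℝ), (∀ F : Finset I, (∀ i ∈ F, α ≤ i) →
      ∫ z, f z * rz c d F z ∂μ.prod ν = t) → ∫ z, f z ∂ρ.1 = t) ∧
    (∀ (f : C(K × L, ℝ)) (t : ℝ) (γ : I), α ≤ γ → (∀ F : Finset I, γ ∈ F →
      t ≤ ∫ z, f z * rz c d F z ∂μ.prod ν) → t ≤ ∫ z, f z ∂ρ.1) := by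
  classical
  let U : Ultrafilter (Finset {i : I // α ≤ i}) := Ultrafilter.of Filter.atTop
  let e : Finset {i : I // α ≤ i} → Finset I := fun F => F.image Subtype.val
  have he : ∀ F, ∀ i ∈ e F, α ≤ i := by
    intro F i hi
    obtain ⟨j, -, rfl⟩ := Finset.mem_image.mp hi
    exact j.2
  have hex : ∀ f : C(K × L, ℝ), ∃ t, Filter.Tendsto
      (fun F => ∫ z, f z * rz c d (e F) z ∂μ.prod ν) U (nhds t) := by
    intro f
    have hc : IsCompact (Icc (-‖f‖) ‖f‖) := isCompact_Icc
    obtain ⟨t, -, ht⟩ := hc.ultrafilter_le_nhds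
      (U.map (fun F => ∫ z, f z * rz c d (e F) z ∂μ.prod ν)) (by
        rw [Filter.le_principal_iff, Ultrafilter.mem_coe, Ultrafilter.mem_map]
        refine Filter.Eventually.of_forall fun F => ?_
        exact abs_le.mp (rz_bound c d (e F) f (cont_measurable f) _ (cont_abs_le f)))
    exact ⟨t, ht⟩
  choose Λ hΛ using hex
  have hR : ∃ ρ : RadonProb (K × L), ∀ f : C(K × L, ℝ), ∫ z, f z ∂ρ.1 = Λ f := by
    refine rmk Λ ?_ ?_ ?_ ?_
    · intro f g
      refine tendsto_nhds_unique (hΛ (f + g)) (((hΛ f).add (hΛ g)).congr fun F => ?_)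
      simp only [ContinuousMap.add_apply, add_mul]
      rw [integral_add (rz_int_mul c d _ (int_cont2 f)) (rz_int_mul c d _ (int_cont2 g))]
    · intro r f
      refine tendsto_nhds_unique (hΛ (r • f)) (((hΛ f).const_mul r).congr fun F => ?_)
      simp only [ContinuousMap.smul_apply, smul_eq_mul, mul_assoc]
      rw [integral_const_mul]
    · intro f g hfg
      refine le_of_tendsto_of_tendsto' (hΛ f) (hΛ g) fun F => ?_
      refine integral_mono (rz_int_mul c d _ (int_cont2 f)) (rz_int_mul c d _ (int_cont2 g)) fun z => ?_
      exact mul_le_mul_of_nonneg_right (hfg z) (rz_nonneg c d _ z)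
    · refine tendsto_nhds_unique (hΛ 1) (tendsto_const_nhds.congr fun F => ?_)
      simp [rz_one]
  obtain ⟨ρ, hρ⟩ := hR
  refine ⟨ρ, ?_, ?_⟩
  · intro f t h
    rw [hρ]
    refine tendsto_nhds_unique (hΛ f) (tendsto_const_nhds.congr fun F => ?_)
    exact (h _ (he F)).symm
  · intro f t γ hγ h
    rw [hρ]
    refine ge_of_tendsto (hΛ f) ?_
    have : ∀ᶠ F in Filter.atTop, t ≤ ∫ z, f z * rz c d (e F) z ∂μ.prod ν := by
      filter_upwards [Filter.eventually_ge_atTop ({⟨γ, hγ⟩} : Finset {i : I // α ≤ i})] with F hF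
      exact h _ (Finset.mem_image.mpr ⟨⟨γ, hγ⟩, hF (Finset.mem_singleton_self _), rfl⟩)
    exact Ultrafilter.of_le _ this

lemma exists_prodRadon (μ : Measure K) (ν : Measure L) [IsProbabilityMeasure μ]
    [IsProbabilityMeasure ν] : ∃ ρ : RadonProb (K × L), ∀ f : C(K × L, ℝ),
    ∫ z, f z ∂ρ.1 = ∫ z, f z ∂μ.prod ν := by
  refine rmk (fun f => ∫ z, f z ∂μ.prod ν) ?_ ?_ ?_ ?_
  · intro f g
    exact integral_add (int_cont2 f) (int_cont2 g)
  · intro r f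
    exact integral_const_mul _ _
  · intro f g h
    exact integral_mono (int_cont2 f) (int_cont2 g) h
  · simp

lemma core (hb : ∀ f : ℕ → I, ∃ b, ∀ n, f n < b) [Nonempty I] [μ.Regular] [ν.Regular]
    (c : Chain I μ) (d : Chain I ν) :
    ¬ CountablyTight (RadonProb (K × L)) := by
  intro hT
  choose δ p q hδ hlow hup using exists_pq c d
  obtain ⟨x, hx⟩ := exists_prodRadon μ ν
  let A : Set (RadonProb (K × L)) :=
    {ρ | ∃ α, ∀ γ, α ≤ γ → 3 * δ γ / 4 ≤ ∫ z, tens (p γ) (q γ) z ∂ρ.1}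
  have hind : Topology.IsInducing
      (fun (ρ : RadonProb (K × L)) (g : C(K × L, ℝ)) => ∫ z, g z ∂ρ.1) := ⟨rfl⟩
  have hxA : x ∈ closure A := by
    rw [hind.closure_eq_preimage_closure_image, mem_preimage, mem_closure_iff_nhds]
    intro t ht
    rw [nhds_pi, Filter.mem_pi'] at ht
    obtain ⟨s, T, hT', hsub⟩ := ht
    choose a ha using cont_limit c d hb
    have hmax : ∃ α, ∀ f ∈ s, a f ≤ α := by
      classical
      obtain ⟨M, hM⟩ := (s.image a).exists_le
      exact ⟨M, fun f hf => hM _ (Finset.mem_image_of_mem a hf)⟩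
    obtain ⟨α, hα⟩ := hmax
    obtain ⟨ρ, h1, h2⟩ := exists_lim c d α
    refine ⟨_, hsub ?_, ρ, ⟨α, fun γ hγ => h2 _ _ γ hγ fun F hF => hlow γ F hF⟩, rfl⟩
    intro f hf
    have : ∫ z, f z ∂ρ.1 = ∫ z, f z ∂x.1 := by
      rw [hx]
      exact h1 f _ fun F hF => ha f F fun i hi => (hα f hf).trans (hF i hi)
    change ∫ z, f z ∂ρ.1 ∈ T f
    rw [this]
    exact mem_of_mem_nhds (hT' f)
  obtain ⟨B, hBA, hBc, hxB⟩ := hT A x hxA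
  have hBne : B.Nonempty := by
    rw [← closure_nonempty_iff]; exact ⟨x, hxB⟩
  obtain ⟨e, rfl⟩ := hBc.exists_eq_range hBne
  choose a ha using fun n : ℕ => hBA (mem_range_self n)
  obtain ⟨γ, hγ⟩ := hb a
  have hcont : Continuous fun ρ : RadonProb (K × L) => ∫ z, tens (p γ) (q γ) z ∂ρ.1 :=
    (continuous_apply (tens (p γ) (q γ))).comp hind.continuous
  have hcl : IsClosed {ρ : RadonProb (K × L) | 3 * δ γ / 4 ≤ ∫ z, tens (p γ) (q γ) z ∂ρ.1} :=
    isClosed_le continuous_const hcont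
  have hsub : closure (range e) ⊆
      {ρ : RadonProb (K × L) | 3 * δ γ / 4 ≤ ∫ z, tens (p γ) (q γ) z ∂ρ.1} := by
    refine closure_minimal ?_ hcl
    rintro _ ⟨n, rfl⟩
    exact ha n γ (hγ n).le
  have h1 : 3 * δ γ / 4 ≤ ∫ z, tens (p γ) (q γ) z ∂x.1 := hsub hxB
  rw [hx] at h1
  linarith [hup γ, hδ γ]

end pair3

lemma reduce {K : Type*} [TopologicalSpace K] [CompactSpace K] [T2Space K]
    [MeasurableSpace K] [BorelSpace K] (μ : Measure K) [IsProbabilityMeasure μ] [μ.InnerRegular]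
    (h : ¬ HasCountableType μ) :
    ∃ μ' : Measure K, IsProbabilityMeasure μ' ∧ μ'.Regular ∧ Nowhere μ' := by
  obtain ⟨D, hD, hD0, hN⟩ := exists_nowhere μ h
  have hP : IsProbabilityMeasure ((μ D)⁻¹ • μ.restrict D) := by
    constructor
    rw [Measure.smul_apply, Measure.restrict_apply_univ, smul_eq_mul,
      ENNReal.inv_mul_cancel hD0 (measure_ne_top _ _)]
  exact ⟨_, hP, inferInstance, hN⟩

/-- If `K` and `L` both carry Radon probability measures of uncountable Maharam type,
then `P(K × L)` does not have countable tightness. -/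
theorem stmt1 (K : Type*) [TopologicalSpace K] [CompactSpace K] [T2Space K]
    (L : Type*) [TopologicalSpace L] [CompactSpace L] [T2Space L]
    (hK : ∃ μ : RadonProb K, ¬ HasCountableType μ.1)
    (hL : ∃ μ : RadonProb L, ¬ HasCountableType μ.1) :
    ¬ CountablyTight (RadonProb (K × L)) := by
  let _ : MeasurableSpace K := borel K
  have _ : BorelSpace K := ⟨rfl⟩
  let _ : MeasurableSpace L := borel L
  have _ : BorelSpace L := ⟨rfl⟩
  obtain ⟨⟨μ, hμP, hμR⟩, hμ⟩ := hK
  obtain ⟨⟨ν, hνP, hνR⟩, hν⟩ := hL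
  obtain ⟨μ', hμ'P, hμ'R, hμ'N⟩ := reduce μ hμ
  obtain ⟨ν', hν'P, hν'R, hν'N⟩ := reduce ν hν
  obtain ⟨I, _, _, _, hI, hb⟩ := exists_index
  obtain ⟨c⟩ := exists_chain I hI μ' hμ'N
  obtain ⟨d⟩ := exists_chain I hI ν' hν'N
  exact core hb c d
end
end

section
/- Let K be a compact Hausdorff space. If P(K×K) has convex countable tightness, i.e. for every M ⊆ P(K×K) and every ν in the weak* closure of M there is a countable N ⊆ M such that ν belongs to the weak* closed convex hull of N, then every Radon probability measure μ ∈ P(K) has countable Maharam type. -/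
open MeasureTheory Set

noncomputable section

theorem aux_riesz (X : Type*) [TopologicalSpace X] [CompactSpace X] [T2Space X]
    (Λ : C(X, ℝ) →ₗ[ℝ] ℝ) (pos : ∀ f : C(X, ℝ), (∀ x, 0 ≤ f x) → 0 ≤ Λ f) (one : Λ 1 = 1) :
    ∃ ν : RadonProb X, ∀ g : C(X, ℝ), ∫ x, g x ∂ν.1 = Λ g := by
  let _ : MeasurableSpace X := borel X
  have : BorelSpace X := ⟨rfl⟩
  let L : CompactlySupportedContinuousMap X ℝ →ₗ[ℝ] ℝ :=
    { toFun := fun f => Λ f.toContinuousMap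
      map_add' := fun f g => by rw [← map_add]; rfl
      map_smul' := fun c f => by rw [RingHom.id_apply, ← map_smul]; rfl }
  let P : CompactlySupportedContinuousMap X ℝ →ₚ[ℝ] ℝ :=
    PositiveLinearMap.mk₀ L (fun f hf => pos _ (fun x => hf x))
  have key : ∀ g : C(X, ℝ), ∫ x, g x ∂(RealRMK.rieszMeasure P) = Λ g := fun g =>
    RealRMK.integral_rieszMeasure P (CompactlySupportedContinuousMap.continuousMapEquiv g)
  have hprob : IsProbabilityMeasure (RealRMK.rieszMeasure P) := by
    have h1 := key 1
    rw [one] at h1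
    simp [Measure.real] at h1
    constructor
    rwa [ENNReal.toReal_eq_one_iff] at h1
  exact ⟨⟨RealRMK.rieszMeasure P, hprob, inferInstance⟩, key⟩

theorem aux_cont_eval (X : Type*) [TopologicalSpace X] (F : C(X, ℝ)) :
    Continuous (fun ν : RadonProb X => ∫ x, F x ∂ν.1) := by
  have h : Continuous (fun (μ : RadonProb X) (g : C(X, ℝ)) => ∫ x, g x ∂μ.1) :=
    continuous_induced_dom
  exact (continuous_apply F).comp h

theorem aux_closed_convex (X : Type*) [TopologicalSpace X] [CompactSpace X]
    (N : Set (RadonProb X)) (F : C(X, ℝ)) (ε : ℝ)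
    (hN : ∀ ν ∈ N, ε ≤ ∫ x, F x ∂ν.1) (ν : RadonProb X)
    (hν : ν ∈ closure (ConvexCombinations N)) : ε ≤ ∫ x, F x ∂ν.1 := by
  let _ : MeasurableSpace X := borel X
  have : BorelSpace X := ⟨rfl⟩
  have hcl : IsClosed {ν : RadonProb X | ε ≤ ∫ x, F x ∂ν.1} :=
    isClosed_le continuous_const (aux_cont_eval X F)
  refine closure_minimal ?_ hcl hν
  rintro ν ⟨n, t, μs, hμ, ht, hsum⟩
  have hint : ∀ i, Integrable (fun x => F x) (μs i).1 := fun i => by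
    have := (μs i).2.1
    exact F.continuous.integrable_of_hasCompactSupport (HasCompactSupport.of_compactSpace _)
  show ε ≤ ∫ x, F x ∂ν.1
  rw [hsum, integral_finsetSum_measure (fun i _ => (hint i).smul_measure ENNReal.coe_ne_top)]
  have ht' : ∑ i, (t i : ℝ) = 1 := by exact_mod_cast ht
  calc ε = ∑ i, (t i : ℝ) * ε := by rw [← Finset.sum_mul, ht', one_mul]
    _ ≤ ∑ i, (t i : ℝ) * ∫ x, F x ∂(μs i).1 :=
        Finset.sum_le_sum fun i _ => mul_le_mul_of_nonneg_left (hN _ (hμ i)) (t i).2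
    _ = _ := by
        refine Finset.sum_congr rfl fun i _ => ?_
        rw [integral_smul_measure]
        simp

theorem aux_integrable {K : Type*} [TopologicalSpace K] [CompactSpace K]
    [MeasurableSpace K] [BorelSpace K] (ν : Measure K) [IsFiniteMeasure ν]
    (f : K → ℝ) (hf : Continuous f) : Integrable f ν :=
  hf.integrable_of_hasCompactSupport (HasCompactSupport.of_compactSpace _)

theorem aux_inner_cont {K : Type*} [TopologicalSpace K] [CompactSpace K]
    [MeasurableSpace K] [BorelSpace K] (ν : Measure K) [IsFiniteMeasure ν]
    (F : C(K × K, ℝ)) : Continuous (fun x => ∫ y, F (x, y) ∂ν) := by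
  have h1 : Continuous (fun g : C(K, ℝ) => ∫ y, g y ∂ν) := by
    let L : C(K, ℝ) →ₗ[ℝ] ℝ :=
      { toFun := fun g => ∫ y, g y ∂ν
        map_add' := fun f g => integral_add (aux_integrable ν _ f.continuous)
          (aux_integrable ν _ g.continuous)
        map_smul' := fun c f => integral_const_mul c _ }
    refine (L.mkContinuous (ν.real univ) fun g => ?_).continuous
    have := norm_integral_le_of_norm_le_const (μ := ν) (f := fun y => g y) (C := ‖g‖)
      (Filter.Eventually.of_forall fun y => g.norm_coe_le_norm y)
    rw [mul_comm]
    exact this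
  exact h1.comp F.curry.continuous

/-- The functional attached to a finite measurable partition. -/
def auxFun {K : Type*} [TopologicalSpace K] [CompactSpace K]
    [MeasurableSpace K] [BorelSpace K] (μ : Measure K) [IsFiniteMeasure μ]
    {n : ℕ} (s : K → Fin n) : C(K × K, ℝ) →ₗ[ℝ] ℝ where
  toFun F := ∑ i, (μ.real (s ⁻¹' {i}))⁻¹ *
    ∫ x in s ⁻¹' {i}, ∫ y in s ⁻¹' {i}, F (x, y) ∂μ ∂μ
  map_add' F G := by
    rw [← Finset.sum_add_distrib]
    refine Finset.sum_congr rfl fun i _ => ?_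
    rw [← mul_add, ← integral_add (aux_integrable _ _ (aux_inner_cont _ F))
      (aux_integrable _ _ (aux_inner_cont _ G))]
    congr 1
    refine integral_congr_ae (Filter.Eventually.of_forall fun x => ?_)
    exact integral_add (aux_integrable _ _ (by fun_prop)) (aux_integrable _ _ (by fun_prop))
  map_smul' c F := by
    simp only [ContinuousMap.smul_apply, smul_eq_mul, integral_const_mul, RingHom.id_apply,
      Finset.mul_sum]
    refine Finset.sum_congr rfl fun i _ => by ring

theorem aux_split {K : Type*} [MeasurableSpace K] (μ : Measure K)
    {n : ℕ} (s : K → Fin n) (hs : Measurable s) (f : K → ℝ) (hf : Integrable f μ) :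
    ∫ x, f x ∂μ = ∑ i, ∫ x in s ⁻¹' {i}, f x ∂μ := by
  rw [← integral_iUnion_fintype (fun i => hs (measurableSet_singleton i))
    (fun i j hij => (disjoint_singleton.2 hij).preimage s) (fun i => hf.integrableOn)]
  have : (⋃ i, s ⁻¹' {i}) = univ := by ext x; simp
  rw [this, Measure.restrict_univ]

theorem aux_approx {K : Type*} [TopologicalSpace K] [CompactSpace K]
    [MeasurableSpace K] [BorelSpace K] (μ : Measure K) [IsProbabilityMeasure μ]
    {n : ℕ} (s : K → Fin n) (hs : Measurable s) (F : C(K × K, ℝ)) (ε : ℝ)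
    (hF : ∀ x y, s x = s y → |F (x, y) - F (x, x)| ≤ ε) :
    |auxFun μ s F - ∫ x, F (x, x) ∂μ| ≤ ε := by
  have hms : ∀ i, MeasurableSet (s ⁻¹' {i}) := fun i => hs (measurableSet_singleton i)
  have h1 : ∑ i, μ.real (s ⁻¹' {i}) = 1 := by
    have := aux_split μ s hs (fun _ => 1) (integrable_const _)
    simp at this
    exact this.symm
  rw [aux_split μ s hs (fun x => F (x, x)) (aux_integrable _ _ (by fun_prop))]
  show |(∑ i, (μ.real (s ⁻¹' {i}))⁻¹ *
    ∫ x in s ⁻¹' {i}, ∫ y in s ⁻¹' {i}, F (x, y) ∂μ ∂μ) - _| ≤ ε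
  rw [← Finset.sum_sub_distrib]
  refine (Finset.abs_sum_le_sum_abs _ _).trans ?_
  calc _ ≤ ∑ i, ε * μ.real (s ⁻¹' {i}) := Finset.sum_le_sum fun i _ => ?_
    _ = ε := by rw [← Finset.mul_sum, h1, mul_one]
  set A := s ⁻¹' {i} with hA
  set m := μ.real A with hm
  rcases eq_or_ne m 0 with h0 | h0
  · have : μ.restrict A = 0 := by
      rw [Measure.restrict_eq_zero]
      simpa [hm, Measure.real, ENNReal.toReal_eq_zero_iff] using h0
    simp [this, h0]
  have hmpos : 0 < m := lt_of_le_of_ne measureReal_nonneg h0.symm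
  have e1 : ∀ x, ∫ y in A, (F (x, y) - F (x, x)) ∂μ = (∫ y in A, F (x, y) ∂μ) - m * F (x, x) := by
    intro x
    rw [integral_sub (aux_integrable _ _ (by fun_prop)) (integrable_const _)]
    simp [hm]
  have e2 : m⁻¹ * (∫ x in A, ∫ y in A, F (x, y) ∂μ ∂μ) - ∫ x in A, F (x, x) ∂μ
      = m⁻¹ * ∫ x in A, ∫ y in A, (F (x, y) - F (x, x)) ∂μ ∂μ := by
    simp_rw [e1]
    rw [integral_sub (aux_integrable _ _ (aux_inner_cont _ F))
      (aux_integrable _ _ (by fun_prop)), integral_const_mul]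
    field_simp
  rw [e2, abs_mul, abs_of_pos (inv_pos.2 hmpos)]
  have e3 : ∀ x ∈ A, ‖∫ y in A, (F (x, y) - F (x, x)) ∂μ‖ ≤ ε * m := fun x hx =>
    norm_setIntegral_le_of_norm_le_const (measure_lt_top _ _) fun y hy => by
      refine hF x y ?_
      rw [show s x = i from hx, show s y = i from hy]
  have e4 : ‖∫ x in A, ∫ y in A, (F (x, y) - F (x, x)) ∂μ ∂μ‖ ≤ ε * m * m :=
    norm_setIntegral_le_of_norm_le_const (measure_lt_top _ _) e3
  rw [Real.norm_eq_abs] at e4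
  calc m⁻¹ * _ ≤ m⁻¹ * (ε * m * m) := by gcongr
    _ = ε * m := by field_simp

theorem aux_exists_meas {K : Type*} [TopologicalSpace K] [CompactSpace K] [T2Space K]
    [MeasurableSpace K] [BorelSpace K] (μ : Measure K) [IsProbabilityMeasure μ]
    {n : ℕ} (s : K → Fin n) (hs : Measurable s) :
    ∃ ν : RadonProb (K × K), ∀ g : C(K × K, ℝ), ∫ x, g x ∂ν.1 = auxFun μ s g := by
  refine aux_riesz (K × K) (auxFun μ s) ?_ ?_
  · intro f hf
    change 0 ≤ ∑ i, (μ.real (s ⁻¹' {i}))⁻¹ *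
      ∫ x in s ⁻¹' {i}, ∫ y in s ⁻¹' {i}, f (x, y) ∂μ ∂μ
    exact Finset.sum_nonneg fun i _ => mul_nonneg (inv_nonneg.2 measureReal_nonneg)
      (integral_nonneg fun x => integral_nonneg fun y => hf _)
  · have := aux_approx μ s hs 1 0 (by simp)
    have h2 := abs_nonpos_iff.1 this
    simp at h2
    linarith

theorem aux_exists_diag {K : Type*} [TopologicalSpace K] [CompactSpace K] [T2Space K]
    [MeasurableSpace K] [BorelSpace K] (μ : Measure K) [IsProbabilityMeasure μ] :
    ∃ ν : RadonProb (K × K), ∀ g : C(K × K, ℝ), ∫ x, g x ∂ν.1 = ∫ x, g (x, x) ∂μ := by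
  refine aux_riesz (K × K)
    { toFun := fun g => ∫ x, g (x, x) ∂μ
      map_add' := fun f g => integral_add (aux_integrable _ _ (by fun_prop))
        (aux_integrable _ _ (by fun_prop))
      map_smul' := fun c f => integral_const_mul c _ } ?_ ?_
  · intro f hf
    exact integral_nonneg fun x => hf _
  · simp

theorem aux_partition {K : Type*} [TopologicalSpace K] [CompactSpace K]
    [MeasurableSpace K] [BorelSpace K] (W : Set (K × K)) (hW : IsOpen W)
    (hd : ∀ x, (x, x) ∈ W) :
    ∃ (n : ℕ) (s : K → Fin n), Measurable s ∧ ∀ x y, s x = s y → (x, y) ∈ W := by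
  classical
  have h1 : ∀ x : K, ∃ V : Set K, IsOpen V ∧ x ∈ V ∧ V ×ˢ V ⊆ W := by
    intro x
    obtain ⟨u, v, hu, hv, hxu, hxv, huv⟩ := isOpen_prod_iff.1 hW x x (hd x)
    exact ⟨u ∩ v, hu.inter hv, ⟨hxu, hxv⟩,
      (prod_mono inter_subset_left inter_subset_right).trans huv⟩
  choose V hV hxV hVW using h1
  obtain ⟨t, ht⟩ := isCompact_univ.elim_finite_subcover V hV
    (fun x _ => mem_iUnion.2 ⟨x, hxV x⟩)
  let s : K → (t → Bool) := fun x i => decide (x ∈ V i)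
  have hs : Measurable s := by
    refine measurable_pi_lambda _ fun i => ?_
    refine measurable_to_bool ?_
    have : (fun x => s x i) ⁻¹' {true} = V i := by ext x; simp [s]
    rw [this]
    exact (hV i).measurableSet
  let e := Fintype.equivFin (t → Bool)
  refine ⟨_, fun x => e (s x), (measurable_of_finite e).comp hs, fun x y hxy => ?_⟩
  have hxy' : s x = s y := e.injective hxy
  obtain ⟨i, hi, hxi⟩ := mem_iUnion₂.1 (ht (mem_univ x))
  have := congrFun hxy' ⟨i, hi⟩
  simp [s, hxi] at this
  exact hVW i ⟨hxi, this⟩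

theorem aux_mem_closure {K : Type*} [TopologicalSpace K] [CompactSpace K] [T2Space K]
    [MeasurableSpace K] [BorelSpace K] (μ : Measure K) [IsProbabilityMeasure μ]
    (δ : RadonProb (K × K))
    (hδ : ∀ g : C(K × K, ℝ), ∫ x, g x ∂δ.1 = ∫ x, g (x, x) ∂μ) :
    δ ∈ closure {ν : RadonProb (K × K) | ∃ (n : ℕ) (s : K → Fin n), Measurable s ∧
      ∀ g : C(K × K, ℝ), ∫ x, g x ∂ν.1 = auxFun μ s g} := by
  rw [mem_closure_iff]
  intro o ho hδo
  obtain ⟨O, hO, rfl⟩ := isOpen_induced_iff.1 ho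
  obtain ⟨I, u, hu, hI⟩ := isOpen_pi_iff.1 hO _ hδo
  have hε : ∀ g : C(K × K, ℝ), ∃ ε > 0, g ∈ I →
      ∀ r : ℝ, |r - ∫ x, g (x, x) ∂μ| ≤ ε → r ∈ u g := by
    intro g
    by_cases hg : g ∈ I
    · obtain ⟨h1, h2⟩ := hu g hg
      obtain ⟨ε, hε, hb⟩ := Metric.nhds_basis_closedBall.mem_iff.1 (h1.mem_nhds h2)
      refine ⟨ε, hε, fun _ r hr => hb ?_⟩
      change dist r (∫ x, g x ∂δ.1) ≤ ε
      rw [hδ, Real.dist_eq]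
      exact hr
    · exact ⟨1, one_pos, fun h => absurd h hg⟩
  choose ε hεpos hε using hε
  obtain ⟨n, s, hs, hW⟩ := aux_partition
    (⋂ g ∈ I, {p : K × K | |g p - g (p.1, p.1)| < ε g})
    (isOpen_biInter_finset fun g _ => isOpen_lt (by fun_prop) continuous_const)
    (fun x => by simp [hεpos])
  obtain ⟨ν, hν⟩ := aux_exists_meas μ s hs
  refine ⟨ν, hI fun g hg => ?_, n, s, hs, hν⟩
  refine hε g hg _ ?_
  show |(∫ x, g x ∂ν.1) - _| ≤ _
  rw [hν]
  refine aux_approx μ s hs g _ fun x y hxy => ?_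
  have := mem_iInter₂.1 (hW x y hxy) g hg
  exact le_of_lt this

theorem aux_simple {K : Type*} [TopologicalSpace K] [CompactSpace K]
    [MeasurableSpace K] [BorelSpace K] (μ : Measure K) [IsProbabilityMeasure μ]
    {n : ℕ} (s : K → Fin n) (hs : Measurable s) (f : C(K, ℝ)) (F : C(K × K, ℝ))
    (hF : ∀ x y, F (x, y) = |f x - f y|) :
    ∃ c : Fin n → ℝ, ∫ x, |f x - c (s x)| ∂μ ≤ auxFun μ s F := by
  have hms : ∀ i, MeasurableSet (s ⁻¹' {i}) := fun i => hs (measurableSet_singleton i)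
  have h1 : ∀ i, ∃ c : ℝ, ∫ x in s ⁻¹' {i}, |f x - c| ∂μ ≤ (μ.real (s ⁻¹' {i}))⁻¹ *
      ∫ x in s ⁻¹' {i}, ∫ y in s ⁻¹' {i}, F (x, y) ∂μ ∂μ := by
    intro i
    by_cases h0 : μ (s ⁻¹' {i}) = 0
    · have : μ.restrict (s ⁻¹' {i}) = 0 := Measure.restrict_eq_zero.2 h0
      exact ⟨0, by simp [this]⟩
    · obtain ⟨x, -, hx⟩ := exists_le_setAverage h0 (measure_ne_top _ _)
        (f := fun x => ∫ y in s ⁻¹' {i}, F (x, y) ∂μ)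
        (aux_integrable _ _ (aux_inner_cont _ F))
      refine ⟨f x, ?_⟩
      rw [setAverage_eq, smul_eq_mul] at hx
      refine le_trans (le_of_eq ?_) hx
      simp_rw [hF, abs_sub_comm]
  choose c hc using h1
  refine ⟨c, ?_⟩
  have hint : Integrable (fun x => |f x - c (s x)|) μ := by
    refine ((aux_integrable μ f f.continuous).sub ?_).abs
    refine Integrable.of_bound ((measurable_of_finite c).comp hs).aestronglyMeasurable
      (∑ i, |c i|) (Filter.Eventually.of_forall fun x => ?_)
    exact Finset.single_le_sum (f := fun i => |c i|) (fun i _ => abs_nonneg _)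
      (Finset.mem_univ (s x))
  rw [aux_split μ s hs _ hint]
  refine Finset.sum_le_sum fun i _ => le_trans (le_of_eq ?_) (hc i)
  refine setIntegral_congr_fun (hms i) fun x hx => ?_
  have : s x = i := hx
  simp [this]

/-- If `P(K × K)` has convex countable tightness, then every Radon probability measure
on `K` has countable Maharam type. -/
theorem stmt2 (K : Type*) [TopologicalSpace K] [CompactSpace K] [T2Space K]
    (h : ∀ (M : Set (RadonProb (K × K))) (ν : RadonProb (K × K)), ν ∈ closure M →
      ∃ N ⊆ M, N.Countable ∧ ν ∈ closure (ConvexCombinations N)) :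
    ∀ μ : RadonProb K, HasCountableType μ.1 := by
  rintro ⟨μ, hμ, hreg⟩
  let _ : MeasurableSpace K := borel K
  have : BorelSpace K := ⟨rfl⟩
  change HasCountableType μ
  obtain ⟨δ, hδ⟩ := aux_exists_diag μ
  obtain ⟨N, hNM, hNc, hN⟩ := h _ δ (aux_mem_closure μ δ hδ)
  have hNM' : ∀ ν ∈ N, ∃ p : (Σ n : ℕ, K → Fin n), Measurable p.2 ∧
      ∀ g : C(K × K, ℝ), ∫ x, g x ∂ν.1 = auxFun μ p.2 g := fun ν hν => by
    obtain ⟨n, s, h1, h2⟩ := hNM hν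
    exact ⟨⟨n, s⟩, h1, h2⟩
  have : Nonempty (Σ n : ℕ, K → Fin n) := ⟨⟨1, fun _ => 0⟩⟩
  choose! p hs hν using hNM'
  let n := fun ν => (p ν).1
  let s := fun ν => (p ν).2
  refine ⟨⋃ ν ∈ N, range (fun T : Set (Fin (n ν)) => s ν ⁻¹' T),
    hNc.biUnion fun ν _ => countable_range _, ?_, ?_⟩
  · intro C hC
    obtain ⟨ν, hνN, T, rfl⟩ := mem_iUnion₂.1 hC
    exact hs ν hνN (Set.toFinite T).measurableSet
  intro B hB ε hε
  obtain ⟨r, hr0, hrε⟩ : ∃ r : ℝ, 0 < r ∧ ENNReal.ofReal r < ε := by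
    obtain ⟨q, hq0, hq⟩ := ENNReal.lt_iff_exists_nnreal_btwn.1 hε
    exact ⟨q, by exact_mod_cast hq0, by simpa using hq⟩
  have hBint : Integrable (B.indicator fun _ => (1 : ℝ)) μ := (integrable_const _).indicator hB
  obtain ⟨f, hf, hfint⟩ := hBint.exists_boundedContinuous_integral_sub_le
    (ε := r / 8) (by positivity)
  let F : C(K × K, ℝ) := ⟨fun p => |f p.1 - f p.2|, by fun_prop⟩
  obtain ⟨ν, hνN, hνF⟩ : ∃ ν ∈ N, ∫ x, F x ∂ν.1 < r / 8 := by
    by_contra! hcon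
    have := aux_closed_convex _ N F (r / 8) hcon δ hN
    rw [hδ] at this
    simp [F] at this
    linarith
  rw [hν ν hνN] at hνF
  obtain ⟨c, hc⟩ := aux_simple μ (s ν) (hs ν hνN) f.toContinuousMap F (fun x y => rfl)
  change ∫ x, |f x - c (s ν x)| ∂μ ≤ _ at hc
  have hcint : Integrable (fun x => c (s ν x)) μ := by
    refine Integrable.of_bound ((measurable_of_finite c).comp (hs ν hνN)).aestronglyMeasurable
      (∑ i, |c i|) (Filter.Eventually.of_forall fun x => ?_)
    exact Finset.single_le_sum (f := fun i => |c i|) (fun i _ => abs_nonneg _)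
      (Finset.mem_univ (s ν x))
  refine ⟨s ν ⁻¹' {i | 1 / 2 < c i}, mem_iUnion₂.2 ⟨ν, hνN, _, rfl⟩, lt_of_le_of_lt ?_ hrε⟩
  set g : K → ℝ := fun x => ‖B.indicator (fun _ => (1 : ℝ)) x - f x‖ + |f x - c (s ν x)| with hg
  have i1 : Integrable (fun x => ‖B.indicator (fun _ => (1 : ℝ)) x - f x‖) μ :=
    (hBint.sub hfint).norm
  have i2 : Integrable (fun x => |f x - c (s ν x)|) μ := (hfint.sub hcint).abs
  have hgint : ∫ x, g x ∂μ ≤ r / 4 := by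
    rw [hg, integral_add i1 i2]
    linarith
  have hmk := mul_meas_ge_le_integral_of_nonneg (μ := μ) (f := g)
    (Filter.Eventually.of_forall fun x => by positivity) (i1.add i2) (1 / 2)
  have hsub : symmDiff B (s ν ⁻¹' {i | 1 / 2 < c i}) ⊆ {x | 1 / 2 ≤ g x} := by
    intro x hx
    have tri : |B.indicator (fun _ => (1 : ℝ)) x - c (s ν x)| ≤ g x := by
      exact abs_sub_le _ _ _
    refine le_trans ?_ tri
    rcases hx with ⟨hxB, hxc⟩ | ⟨hxc, hxB⟩
    · have : c (s ν x) ≤ 1 / 2 := not_lt.1 hxc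
      rw [indicator_of_mem hxB]
      exact le_trans (by linarith) (le_abs_self _)
    · have : 1 / 2 < c (s ν x) := hxc
      rw [indicator_of_notMem hxB]
      exact le_trans (by linarith) (neg_le_abs _)
  refine (measure_mono hsub).trans ?_
  rw [← ENNReal.ofReal_toReal (measure_ne_top μ {x | 1 / 2 ≤ g x})]
  refine ENNReal.ofReal_le_ofReal ?_
  change μ.real {x | 1 / 2 ≤ g x} ≤ r
  linarith
end
end

section
/- If K is Rosenthal compact, i.e. K is homeomorphic to a compact subset of the space of Baire-one real-valued functions on some Polish space X endowed with the topology of pointwise convergence, then every Radon probability measure μ ∈ P(K) has countable Maharam type. -/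
open MeasureTheory Set

noncomputable section

namespace RosAux

open MeasurableSpace

/-- Essential union of a family of sets is attained by a countable subfamily. -/
lemma ess_union {K : Type*} [MeasurableSpace K] (μ : Measure K) [IsFiniteMeasure μ]
    (F : Set (Set K)) (hF : ∀ A ∈ F, MeasurableSet A) (hne : F.Nonempty) :
    ∃ E : ℕ → Set K, (∀ n, E n ∈ F) ∧ ∀ A ∈ F, μ (A \ ⋃ n, E n) = 0 := by
  classical
  let S : Set ENNReal := {r | ∃ E : ℕ → Set K, (∀ n, E n ∈ F) ∧ r = μ (⋃ n, E n)}
  obtain ⟨A0, hA0⟩ := hne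
  have hSne : S.Nonempty := ⟨_, fun _ => A0, fun _ => hA0, rfl⟩
  obtain ⟨u, -, hu, huS⟩ := exists_seq_tendsto_sSup hSne (OrderTop.bddAbove S)
  choose E hE hEu using huS
  let G : ℕ → Set K := fun n => E n.unpair.1 n.unpair.2
  have hG : ∀ n, G n ∈ F := fun n => hE _ _
  have hsub : ∀ i, (⋃ n, E i n) ⊆ ⋃ n, G n := by
    intro i
    refine iUnion_subset fun j => ?_
    have : G (Nat.pair i j) = E i j := by simp [G]
    rw [← this]
    exact subset_iUnion G _
  have hle : sSup S ≤ μ (⋃ n, G n) := by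
    refine le_of_tendsto' hu fun i => ?_
    rw [hEu i]
    exact measure_mono (hsub i)
  refine ⟨G, hG, fun A hA => ?_⟩
  have hH : μ (A ∪ ⋃ n, G n) ≤ sSup S := by
    refine le_sSup ⟨fun n => Nat.casesOn n A G, ?_, ?_⟩
    · intro n; cases n
      · exact hA
      · exact hG _
    · congr 1
      ext k
      simp only [mem_union, mem_iUnion]
      constructor
      · rintro (h | ⟨i, h⟩)
        · exact ⟨0, h⟩
        · exact ⟨i + 1, h⟩
      · rintro ⟨n, h⟩
        cases n with
        | zero => exact Or.inl h
        | succ n => exact Or.inr ⟨n, h⟩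
  have h1 : μ (A \ ⋃ n, G n) + μ (⋃ n, G n) = μ (A ∪ ⋃ n, G n) := by
    rw [← measure_union disjoint_sdiff_left
      (MeasurableSet.iUnion fun n => hF _ (hG n)), sdiff_union_self]
  have h2 : μ (A \ ⋃ n, G n) + μ (⋃ n, G n) ≤ 0 + μ (⋃ n, G n) := by
    rw [h1, zero_add]; exact hH.trans hle
  exact le_antisymm ((ENNReal.add_le_add_iff_right (measure_ne_top _ _)).1 h2) (zero_le)

/-- Measurable gluing along a countable family of measurable sets. -/
lemma glue {K : Type*} (m : MeasurableSpace K) (E : ℕ → Set K) (s : ℕ → K → ℝ)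
    (hE : ∀ n, MeasurableSet[m] (E n)) (hs : ∀ n, Measurable[m] (s n)) :
    ∃ t : K → ℝ, Measurable[m] t ∧ ∀ k ∈ ⋃ n, E n, ∃ n, k ∈ E n ∧ t k = s n k := by
  classical
  let p : ℕ → K → Prop := fun n k => k ∈ E n ∨ k ∉ ⋃ n, E n
  have hp : ∀ n, MeasurableSet {k | p n k} := fun n =>
    (hE n).union (MeasurableSet.iUnion hE).compl
  have hex : ∀ k, ∃ n, p n k := by
    intro k
    by_cases h : k ∈ ⋃ n, E n
    · obtain ⟨n, hn⟩ := mem_iUnion.1 h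
      exact ⟨n, Or.inl hn⟩
    · exact ⟨0, Or.inr h⟩
  refine ⟨fun k => s (Nat.find (hex k)) k, Measurable.find hs hp hex, fun k hk => ?_⟩
  refine ⟨Nat.find (hex k), ?_, rfl⟩
  exact (Nat.find_spec (hex k)).resolve_right (fun h => h hk)

/-- The evaluations at points of `U` are, up to `δ` on `A`, measurable with respect to a
countably generated sub-σ-algebra. -/
def Good {K X : Type*} [MeasurableSpace K] (μ : Measure K) (e : K → X → ℝ) (δ : ℝ)
    (U : Set X) (A : Set K) : Prop :=
  ∃ b : Set (Set K), b.Countable ∧ (∀ s ∈ b, MeasurableSet s) ∧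
    ∀ x ∈ U, ∃ s : K → ℝ, Measurable[generateFrom b] s ∧ ∀ᵐ k ∂μ, k ∈ A → |e k x - s k| ≤ δ

lemma Good.iUnion {K X : Type*} [MeasurableSpace K] {μ : Measure K} {e : K → X → ℝ} {δ : ℝ}
    {U : Set X} {A : ℕ → Set K} (hA : ∀ n, MeasurableSet (A n)) (h : ∀ n, Good μ e δ U (A n)) :
    Good μ e δ U (⋃ n, A n) := by
  choose b hbc hbm hb using h
  refine ⟨(⋃ n, b n) ∪ range A, (countable_iUnion hbc).union (countable_range A), ?_, ?_⟩
  · rintro s (hs | ⟨n, rfl⟩)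
    · obtain ⟨n, hn⟩ := mem_iUnion.1 hs
      exact hbm n s hn
    · exact hA n
  · intro x hx
    choose s hs hsa using fun n => hb n x hx
    obtain ⟨t, ht, htE⟩ := glue (generateFrom ((⋃ n, b n) ∪ range A)) A s
      (fun n => measurableSet_generateFrom (Or.inr ⟨n, rfl⟩))
      (fun n => (hs n).mono (generateFrom_mono
        ((subset_iUnion b n).trans subset_union_left)) le_rfl)
    refine ⟨t, ht, ?_⟩
    filter_upwards [ae_all_iff.2 hsa] with k hk hkA
    obtain ⟨n, hn, hn'⟩ := htE k hkA
    rw [hn']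
    exact hk n hn

lemma gen_le {K : Type*} [m : MeasurableSpace K] {b : Set (Set K)}
    (hb : ∀ s ∈ b, MeasurableSet s) : generateFrom b ≤ m := generateFrom_le hb

lemma Good.hull {K X : Type*} [MeasurableSpace K] {μ : Measure K} [IsFiniteMeasure μ]
    {e : K → X → ℝ} (hm : ∀ x, Measurable fun k => e k x) {δ : ℝ}
    {U : Set X} {A : Set K} (h : Good μ e δ U A) : Good μ e δ U (toMeasurable μ A) := by
  obtain ⟨b, hbc, hbm, hb⟩ := h
  refine ⟨b, hbc, hbm, fun x hx => ?_⟩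
  obtain ⟨s, hs, hsa⟩ := hb x hx
  refine ⟨s, hs, ?_⟩
  have hs' : Measurable s := hs.mono (gen_le hbm) le_rfl
  have hT : MeasurableSet {k | ¬ |e k x - s k| ≤ δ} :=
    (measurableSet_le ((hm x).sub hs').abs measurable_const).compl
  have h0 := Measure.measure_toMeasurable_inter (μ := μ) hT (measure_ne_top μ A)
  rw [ae_iff] at hsa ⊢
  have e1 : {k | ¬ (k ∈ A → |e k x - s k| ≤ δ)} = A ∩ {k | ¬ |e k x - s k| ≤ δ} := by
    ext k; simp
  have e2 : {k | ¬ (k ∈ toMeasurable μ A → |e k x - s k| ≤ δ)} =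
      toMeasurable μ A ∩ {k | ¬ |e k x - s k| ≤ δ} := by
    ext k; simp
  rw [e1] at hsa
  rw [e2, h0, hsa]

lemma exists_max {K X : Type*} [MeasurableSpace K] (μ : Measure K) [IsFiniteMeasure μ]
    (e : K → X → ℝ) (hm : ∀ x, Measurable fun k => e k x) (δ : ℝ) (U : Set X) :
    ∃ B : Set K, MeasurableSet B ∧ Good μ e δ U B ∧ ∀ A, Good μ e δ U A → μ (A \ B) = 0 := by
  obtain ⟨E, hE, hEm⟩ := ess_union μ {A | MeasurableSet A ∧ Good μ e δ U A} (fun A h => h.1)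
    ⟨∅, MeasurableSet.empty, ∅, countable_empty, by simp, fun x _ =>
      ⟨fun _ => 0, measurable_const, by simp⟩⟩
  refine ⟨⋃ n, E n, MeasurableSet.iUnion fun n => (hE n).1,
    Good.iUnion (fun n => (hE n).1) fun n => (hE n).2, fun A hA => ?_⟩
  refine measure_mono_null ?_ (hEm (toMeasurable μ A) ⟨measurableSet_toMeasurable _ _, hA.hull hm⟩)
  exact sdiff_subset_sdiff_left (subset_toMeasurable μ A)

theorem core {K X : Type*} [MeasurableSpace K] (μ : Measure K) [IsFiniteMeasure μ]
    [TopologicalSpace X] [SecondCountableTopology X]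
    (e : K → X → ℝ) (hm : ∀ x, Measurable fun k => e k x) (δ : ℝ) (hδ : 0 < δ)
    (hosc : ∀ k, ∀ C : Set X, IsClosed C → C.Nonempty → ∃ U : Set X, IsOpen U ∧
      (U ∩ C).Nonempty ∧ ∀ x ∈ U ∩ C, ∀ y ∈ U ∩ C, |e k x - e k y| ≤ δ) :
    Good μ e δ univ univ := by
  classical
  obtain ⟨U, hU⟩ : ∃ U : ℕ → Set X, TopologicalSpace.IsTopologicalBasis (range U) := by
    obtain ⟨b, hbc, -, hb⟩ := TopologicalSpace.exists_countable_basis X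
    obtain ⟨U, hU⟩ := (hbc.insert ∅).exists_eq_range (insert_nonempty _ _)
    exact ⟨U, hU ▸ hb.insert_empty⟩
  choose B hBm hBG hBmax using fun n => exists_max μ e hm δ (U n)
  choose b hbc hbm hb using hBG
  let b0 : Set (Set K) := (⋃ n, b n) ∪ range B
  have hb0c : b0.Countable := (countable_iUnion hbc).union (countable_range B)
  have hb0m : ∀ s ∈ b0, MeasurableSet s := by
    rintro s (hs | ⟨n, rfl⟩)
    · obtain ⟨n, hn⟩ := mem_iUnion.1 hs
      exact hbm n s hn
    · exact hBm n
  let E : X → ℕ → Set K := fun x n => if x ∈ U n then B n else ∅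
  have hE : ∀ x n, MeasurableSet[generateFrom b0] (E x n) := by
    intro x n
    by_cases h : x ∈ U n
    · simp only [E, if_pos h]
      exact measurableSet_generateFrom (Or.inr ⟨n, rfl⟩)
    · simp only [E, if_neg h]
      exact @MeasurableSet.empty _ (generateFrom b0)
  let W : X → Set K := fun x => ⋃ n, E x n
  have hW : ∀ x, MeasurableSet[generateFrom b0] (W x) := fun x =>
    @MeasurableSet.iUnion _ _ (generateFrom b0) _ _ (hE x)
  have memW : ∀ x k, k ∈ W x ↔ ∃ n, x ∈ U n ∧ k ∈ B n := by
    intro x k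
    simp only [W, E, mem_iUnion]
    refine exists_congr fun n => ?_
    by_cases h : x ∈ U n <;> simp [h]
  have hWs : ∀ x, ∃ s : K → ℝ, Measurable[generateFrom b0] s ∧
      ∀ᵐ k ∂μ, k ∈ W x → |e k x - s k| ≤ δ := by
    intro x
    have hn : ∀ n, ∃ s : K → ℝ, Measurable[generateFrom b0] s ∧
        ∀ᵐ k ∂μ, k ∈ E x n → |e k x - s k| ≤ δ := by
      intro n
      by_cases h : x ∈ U n
      · obtain ⟨s, hs, hsa⟩ := hb n x h
        refine ⟨s, hs.mono (generateFrom_mono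
          ((subset_iUnion b n).trans subset_union_left)) le_rfl, ?_⟩
        simpa only [E, if_pos h] using hsa
      · exact ⟨fun _ => 0, measurable_const, by simp [E, h]⟩
    choose s hs hsa using hn
    obtain ⟨t, ht, htE⟩ := glue (generateFrom b0) (E x) s (hE x) hs
    refine ⟨t, ht, ?_⟩
    filter_upwards [ae_all_iff.2 hsa] with k hk hkA
    obtain ⟨n, hn, hn'⟩ := htE k hkA
    rw [hn']
    exact hk n hn
  let C : K → Set X := fun k => {x | k ∉ W x}
  have hC : ∀ k, IsClosed (C k) := by
    intro k
    rw [← isOpen_compl_iff, isOpen_iff_mem_nhds]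
    intro x hx
    have hx' : k ∈ W x := not_not.1 hx
    obtain ⟨n, hn, hkn⟩ := (memW x k).1 hx'
    refine Filter.mem_of_superset ((hU.isOpen ⟨n, rfl⟩).mem_nhds hn) fun y hy => ?_
    exact not_not.2 ((memW y k).2 ⟨n, hy, hkn⟩)
  let A : ℕ → Set K := fun n => {k | (U n ∩ C k).Nonempty ∧
    ∀ x ∈ U n ∩ C k, ∀ y ∈ U n ∩ C k, |e k x - e k y| ≤ δ}
  have hAG : ∀ n, Good μ e δ (U n) (A n) := by
    intro n
    by_cases hne : (U n).Nonempty
    swap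
    · exact ⟨∅, countable_empty, by simp, fun x hx => (hne ⟨x, hx⟩).elim⟩
    obtain ⟨F, hF, hFm⟩ := ess_union μ ((fun y => (W y)ᶜ) '' U n)
      (by rintro _ ⟨y, -, rfl⟩; exact (gen_le hb0m _ (hW y)).compl) (hne.image _)
    choose y hyU hyF using hF
    let b1 : Set (Set K) := b0 ∪ ⋃ i, (fun T => (fun k => e k (y i)) ⁻¹' T) ''
      (countableGeneratingSet ℝ)
    have hb1m : ∀ s ∈ b1, MeasurableSet s := by
      rintro s (hs | hs)
      · exact hb0m s hs
      · obtain ⟨i, T, hT, rfl⟩ := mem_iUnion.1 hs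
        exact hm (y i) (measurableSet_countableGeneratingSet hT)
    have hey : ∀ i, Measurable[generateFrom b1] fun k => e k (y i) := by
      intro i
      rw [← generateFrom_countableGeneratingSet (α := ℝ)]
      refine @measurable_generateFrom _ _ (generateFrom b1) _ _ fun T hT => ?_
      exact measurableSet_generateFrom (Or.inr (mem_iUnion.2 ⟨i, T, hT, rfl⟩))
    have h01 : generateFrom b0 ≤ generateFrom b1 := generateFrom_mono subset_union_left
    refine ⟨b1, hb0c.union (countable_iUnion fun i =>
      countable_countableGeneratingSet.image _), hb1m, fun x hx => ?_⟩
    obtain ⟨s, hs, hsa⟩ := hWs x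
    obtain ⟨t, ht, htE⟩ := glue (generateFrom b1)
      (fun j => Nat.casesOn j (W x) fun i => (W (y i))ᶜ ∩ (W x)ᶜ)
      (fun j => Nat.casesOn j s fun i k => e k (y i))
      (by
        intro j
        cases j with
        | zero => exact h01 _ (hW x)
        | succ i =>
          exact @MeasurableSet.inter _ (generateFrom b1) _ _
            (@MeasurableSet.compl _ _ (generateFrom b1) (h01 _ (hW (y i))))
            (@MeasurableSet.compl _ _ (generateFrom b1) (h01 _ (hW x))))
      (by
        intro j
        cases j with
        | zero => exact hs.mono h01 le_rfl
        | succ i => exact hey i)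
    refine ⟨t, ht, ?_⟩
    have hcov : ∀ᵐ k ∂μ, k ∉ (W x)ᶜ \ ⋃ i, F i :=
      measure_eq_zero_iff_ae_notMem.1 (hFm _ ⟨x, hx, rfl⟩)
    filter_upwards [hsa, hcov] with k hk hkc hkA
    have hkU : k ∈ ⋃ j : ℕ, (Nat.casesOn j (W x) fun i => (W (y i))ᶜ ∩ (W x)ᶜ : Set K) := by
      by_cases hkW : k ∈ W x
      · exact mem_iUnion.2 ⟨0, hkW⟩
      · have : k ∈ ⋃ i, F i := by
          by_contra hcon
          exact hkc ⟨hkW, hcon⟩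
        obtain ⟨i, hi⟩ := mem_iUnion.1 this
        rw [← hyF i] at hi
        exact mem_iUnion.2 ⟨i + 1, hi, hkW⟩
    obtain ⟨j, hj, hj'⟩ := htE k hkU
    rw [hj']
    cases j with
    | zero => exact hk hj
    | succ i => exact hkA.2 x ⟨hx, hj.2⟩ (y i) ⟨hyU i, hj.1⟩
  have hA0 : ∀ n, μ (A n) = 0 := by
    intro n
    refine measure_mono_null ?_ (hBmax n (A n) (hAG n))
    intro k hk
    refine ⟨hk, fun hkB => ?_⟩
    obtain ⟨x, hxU, hxC⟩ := hk.1
    exact hxC ((memW x k).2 ⟨n, hxU, hkB⟩)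
  have hfin : ∀ᵐ k ∂μ, C k = ∅ := by
    have : ∀ᵐ k ∂μ, ∀ n, k ∉ A n := ae_all_iff.2 fun n =>
      measure_eq_zero_iff_ae_notMem.1 (hA0 n)
    filter_upwards [this] with k hk
    by_contra hcon
    obtain ⟨V, hV, ⟨x, hxV, hxC⟩, hVo⟩ := hosc k (C k) (hC k) (nonempty_iff_ne_empty.2 hcon)
    obtain ⟨_, ⟨n, rfl⟩, hxn, hnV⟩ := hU.exists_subset_of_mem_open hxV hV
    exact hk n ⟨⟨x, hxn, hxC⟩, fun x hx y hy =>
      hVo x ⟨hnV hx.1, hx.2⟩ y ⟨hnV hy.1, hy.2⟩⟩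
  refine ⟨b0, hb0c, hb0m, fun x _ => ?_⟩
  obtain ⟨s, hs, hsa⟩ := hWs x
  refine ⟨s, hs, ?_⟩
  filter_upwards [hsa, hfin] with k hk hkC _
  refine hk ?_
  by_contra hcon
  have : x ∈ C k := hcon
  rw [hkC] at this
  exact this

/-- Point-of-continuity property of Baire-one functions. -/
lemma baire_osc {X : Type*} [TopologicalSpace X] [PolishSpace X] (f : X → ℝ) (g : ℕ → X → ℝ)
    (hg : ∀ n, Continuous (g n))
    (hf : ∀ x, Filter.Tendsto (fun n => g n x) Filter.atTop (nhds (f x)))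
    (δ : ℝ) (hδ : 0 < δ) (C : Set X) (hC : IsClosed C) (hne : C.Nonempty) :
    ∃ U : Set X, IsOpen U ∧ (U ∩ C).Nonempty ∧ ∀ x ∈ U ∩ C, ∀ y ∈ U ∩ C, |f x - f y| ≤ δ := by
  have : PolishSpace C := hC.polishSpace
  have : Nonempty C := hne.to_subtype
  letI := TopologicalSpace.upgradeIsCompletelyMetrizable C
  let F : ℕ → Set C := fun N => {x | ∀ n, N ≤ n → |g n x - g N x| ≤ δ / 4}
  have hF : ∀ N, IsClosed (F N) := by
    intro N
    have : F N = ⋂ n, ⋂ (_ : N ≤ n), {x : C | |g n x - g N x| ≤ δ / 4} := by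
      ext x; simp [F]
    rw [this]
    refine isClosed_iInter fun n => isClosed_iInter fun _ => ?_
    exact isClosed_le ((((hg n).comp continuous_subtype_val).sub
      ((hg N).comp continuous_subtype_val)).abs) continuous_const
  have hcov : ⋃ N, F N = univ := by
    refine eq_univ_of_forall fun x => ?_
    obtain ⟨N, hN⟩ := Metric.tendsto_atTop.1 (hf x) (δ / 8) (by positivity)
    refine mem_iUnion.2 ⟨N, fun n hn => ?_⟩
    have h1 := hN n hn
    have h2 := hN N le_rfl
    rw [Real.dist_eq] at h1 h2
    rw [abs_lt] at h1 h2
    rw [abs_le]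
    constructor <;> linarith
  obtain ⟨N, x0, hx0⟩ := nonempty_interior_of_iUnion_of_closed hF hcov
  obtain ⟨V, hV, hVF⟩ := isOpen_induced_iff.1 (isOpen_interior (s := F N))
  refine ⟨V ∩ {x | |g N x - g N x0| < δ / 4}, hV.inter
    (isOpen_lt (((hg N).sub continuous_const).abs) continuous_const), ?_, ?_⟩
  · have : x0 ∈ Subtype.val ⁻¹' V := hVF ▸ hx0
    exact ⟨x0, ⟨this, by simp; positivity⟩, x0.2⟩
  · have key : ∀ x ∈ (V ∩ {x | |g N x - g N x0| < δ / 4}) ∩ C, |f x - g N x0| ≤ δ / 2 := by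
      rintro x ⟨⟨hxV, hx⟩, hxC⟩
      have hxF : (⟨x, hxC⟩ : C) ∈ F N := by
        refine interior_subset ?_
        rw [← hVF]; exact hxV
      have h1 : |f x - g N x| ≤ δ / 4 := by
        refine le_of_tendsto (((hf x).sub_const _).abs) ?_
        filter_upwards [Filter.eventually_ge_atTop N] with n hn
        exact hxF n hn
      have h2 : |g N x - g N x0| < δ / 4 := hx
      rw [abs_le] at *
      rw [abs_lt] at h2
      constructor <;> linarith
    intro x hx y hy
    have h1 := key x hx
    have h2 := key y hy
    rw [abs_le] at *
    constructor <;> linarith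

lemma borel_in {K : Type*} [TopologicalSpace K] [CompactSpace K] [T2Space K]
    (M : MeasurableSpace K) [mK : MeasurableSpace K] [BorelSpace K] (μ : Measure K)
    [IsFiniteMeasure μ] [μ.InnerRegular]
    (hM : ∀ s t : Set K, MeasurableSet[M] s → s =ᵐ[μ] t → MeasurableSet[M] t)
    {X : Type*} (e : K → X → ℝ) (he : Continuous e) (hinj : Function.Injective e)
    (hmeas : ∀ x, Measurable[M] fun k => e k x) (S : Set K) (hS : MeasurableSet S) :
    MeasurableSet[M] S := by
  have hec : ∀ x, Continuous fun k => e k x := fun x => (continuous_apply x).comp he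
  let 𝒜 : Subalgebra ℝ C(K, ℝ) :=
    { carrier := {φ | Measurable[M] φ}
      mul_mem' := fun {a b} ha hb => Measurable.mul (m := M) (f := a) (g := b) ha hb
      add_mem' := fun {a b} ha hb => Measurable.add (m := M) (f := a) (g := b) ha hb
      algebraMap_mem' := fun r => @measurable_const _ _ _ M r }
  have hsep : 𝒜.SeparatesPoints := by
    intro k l hkl
    obtain ⟨x, hx⟩ : ∃ x, e k x ≠ e l x := by
      by_contra hcon
      push Not at hcon
      exact hkl (hinj (funext hcon))
    exact ⟨fun k => e k x, ⟨⟨fun k => e k x, hec x⟩, hmeas x, rfl⟩, hx⟩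
  have htop := ContinuousMap.subalgebra_topologicalClosure_eq_top_of_separatesPoints 𝒜 hsep
  have hcont : ∀ φ : C(K, ℝ), Measurable[M] φ := by
    intro φ
    have h1 : φ ∈ closure (𝒜 : Set C(K, ℝ)) := by
      rw [← Subalgebra.topologicalClosure_coe, htop]; trivial
    obtain ⟨u, hu, hut⟩ := mem_closure_iff_seq_limit.1 h1
    refine @measurable_of_tendsto_metrizable _ _ M _ _ _ _ (fun n k => u n k) φ hu ?_
    rw [tendsto_pi_nhds]
    intro k
    exact ((continuous_eval_const (F := C(K, ℝ)) k).tendsto φ).comp hut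
  have happrox : ∀ T : Set K, MeasurableSet T → ∃ L : ℕ → Set K,
      (∀ n, IsCompact (L n)) ∧ (∀ n, L n ⊆ T) ∧ μ (T \ ⋃ n, L n) = 0 := by
    intro T hT
    have hex : ∀ n : ℕ, ∃ L ⊆ T, IsCompact L ∧ μ (T \ L) < ((n : ENNReal) + 1)⁻¹ := by
      intro n
      exact hT.exists_isCompact_sdiff_lt (measure_ne_top _ _) (by simp)
    choose L hLT hLc hL using hex
    refine ⟨L, hLc, hLT, ?_⟩
    refine le_antisymm (le_of_forall_pos_le_add ?_) zero_le
    intro ε hε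
    obtain ⟨n, hn⟩ := ENNReal.exists_inv_nat_lt hε.ne'
    rw [zero_add]
    refine (measure_mono (sdiff_subset_sdiff_right (subset_iUnion L n))).trans ((hL n).le.trans ?_)
    refine le_trans ?_ hn.le
    rw [ENNReal.inv_le_inv]
    exact le_self_add
  have hcpt : ∀ L : Set K, IsCompact L → MeasurableSet[M] L := by
    intro L hL
    obtain ⟨P, hPc, hPL, hP⟩ := happrox Lᶜ hL.measurableSet.compl
    have hφ : ∀ n, ∃ φ : C(K, ℝ), EqOn φ 0 (P n) ∧ EqOn φ 1 L ∧ ∀ x, φ x ∈ Icc (0 : ℝ) 1 :=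
      fun n => exists_continuous_zero_one_of_isClosed (hPc n).isClosed hL.isClosed
        (disjoint_left.2 fun x hx hx' => hPL n hx hx')
    choose φ h0 h1 _ using hφ
    refine hM (⋂ n, φ n ⁻¹' {1}) L (@MeasurableSet.iInter _ _ M _ _ fun n =>
      hcont (φ n) (measurableSet_singleton 1)) ?_
    have hae : ∀ᵐ k ∂μ, k ∉ Lᶜ \ ⋃ n, P n := measure_eq_zero_iff_ae_notMem.1 hP
    rw [Filter.eventuallyEq_set]
    filter_upwards [hae] with k hk
    constructor
    · intro h
      by_contra hkL
      have : k ∈ ⋃ n, P n := by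
        by_contra hcon
        exact hk ⟨hkL, hcon⟩
      obtain ⟨n, hn⟩ := mem_iUnion.1 this
      have h2 : φ n k = 1 := mem_iInter.1 h n
      have h3 := h0 n hn
      rw [h2] at h3
      simp at h3
    · intro h
      exact mem_iInter.2 fun n => h1 n h
  obtain ⟨L, hLc, hLS, hL⟩ := happrox S hS
  refine hM (⋃ n, L n) S (@MeasurableSet.iUnion _ _ M _ _ fun n => hcpt _ (hLc n)) ?_
  have hae : ∀ᵐ k ∂μ, k ∉ S \ ⋃ n, L n := measure_eq_zero_iff_ae_notMem.1 hL
  rw [Filter.eventuallyEq_set]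
  filter_upwards [hae] with k hk
  constructor
  · intro h
    exact iUnion_subset hLS h
  · intro h
    by_contra hcon
    exact hk ⟨h, hcon⟩

lemma sep_dense {K : Type*} (m : MeasurableSpace K) [CountablyGenerated K] (ν : Measure K)
    [IsFiniteMeasure ν] : ∃ 𝒜 : Set (Set K), 𝒜.Countable ∧ (∀ s ∈ 𝒜, MeasurableSet s) ∧
      ∀ s, MeasurableSet s → ∀ ε : ℝ, 0 < ε → ∃ t ∈ 𝒜, ν (symmDiff s t) < ENNReal.ofReal ε := by
  obtain ⟨𝒜, h1, h2⟩ := exists_countable_measureDense ν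
  exact ⟨𝒜, h1, h2.measurable, fun s hs => h2.approx s hs (measure_ne_top _ _)⟩

theorem main {K : Type*} [TopologicalSpace K] [CompactSpace K] [T2Space K]
    [mK : MeasurableSpace K] [BorelSpace K] (μ : Measure K) [IsFiniteMeasure μ]
    [μ.InnerRegular] {X : Type*} [TopologicalSpace X] [PolishSpace X] (e : K → X → ℝ)
    (he : Continuous e) (hinj : Function.Injective e)
    (hb : ∀ k : K, ∃ g : ℕ → X → ℝ, (∀ n, Continuous (g n)) ∧
        ∀ x : X, Filter.Tendsto (fun n => g n x) Filter.atTop (nhds (e k x))) :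
    HasCountableType μ := by
  have hec : ∀ x, Continuous fun k => e k x := fun x => (continuous_apply x).comp he
  have hgood : ∀ n : ℕ, Good μ e (1 / ((n : ℝ) + 1)) univ univ := by
    intro n
    refine core μ e (fun x => (hec x).measurable) _ Nat.one_div_pos_of_nat fun k C hC hne => ?_
    obtain ⟨g, hg, hgt⟩ := hb k
    exact baire_osc (e k) g hg hgt _ Nat.one_div_pos_of_nat C hC hne
  choose b hbc hbm hs using hgood
  let c : Set (Set K) := ⋃ n, b n
  have hcc : c.Countable := countable_iUnion hbc
  have hcm : ∀ s ∈ c, MeasurableSet s := by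
    intro s hs
    obtain ⟨n, hn⟩ := mem_iUnion.1 hs
    exact hbm n s hn
  have hle : generateFrom c ≤ mK := gen_le hcm
  have hM : ∀ s t : Set K, MeasurableSet[eventuallyMeasurableSpace (generateFrom c) (ae μ)] s → s =ᵐ[μ] t → MeasurableSet[eventuallyMeasurableSpace (generateFrom c) (ae μ)] t := by
    intro s t hs hst
    exact EventuallyMeasurableSet.congr hs hst.symm
  have hmeas : ∀ x, Measurable[eventuallyMeasurableSpace (generateFrom c) (ae μ)] fun k => e k x := by
    intro x
    choose s hs' hsa using fun n => hs n x (mem_univ x)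
    have hlim : Measurable[generateFrom c] fun k => Filter.limsup (fun n => s n k) Filter.atTop :=
      Measurable.limsup (mδ := generateFrom c) fun n =>
        (hs' n).mono (generateFrom_mono (subset_iUnion b n)) le_rfl
    refine Measurable.eventuallyMeasurable_of_eventuallyEq hlim ?_
    filter_upwards [ae_all_iff.2 hsa] with k hk
    symm
    refine Filter.Tendsto.limsup_eq ?_
    rw [tendsto_iff_dist_tendsto_zero]
    refine squeeze_zero (fun _ => dist_nonneg) (fun n => ?_)
      tendsto_one_div_add_atTop_nhds_zero_nat
    rw [dist_comm, Real.dist_eq]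
    exact hk n (mem_univ k)
  have hall := borel_in (eventuallyMeasurableSpace (generateFrom c) (ae μ)) μ hM e he hinj hmeas
  have hcg : @CountablyGenerated K (generateFrom c) := @CountablyGenerated.mk _ (generateFrom c) ⟨c, hcc, rfl⟩
  obtain ⟨𝒜, h𝒜c, h𝒜m, h𝒜⟩ := @sep_dense K (generateFrom c) hcg (μ.trim hle) inferInstance
  refine ⟨𝒜, h𝒜c, fun C hC => hle _ (h𝒜m C hC), fun B hB ε hε => ?_⟩
  obtain ⟨D, hD, hBD⟩ := hall B hB
  have hε' : 0 < (min ε 1).toReal :=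
    ENNReal.toReal_pos (lt_min hε one_pos).ne' (ne_top_of_le_ne_top ENNReal.one_ne_top (min_le_right _ _))
  obtain ⟨C, hC, hDC⟩ := h𝒜 D hD _ hε'
  refine ⟨C, hC, ?_⟩
  rw [ENNReal.ofReal_toReal (ne_top_of_le_ne_top ENNReal.one_ne_top (min_le_right _ _)),
    trim_measurableSet_eq hle (@MeasurableSet.symmDiff _ (generateFrom c) _ _ hD (h𝒜m C hC))] at hDC
  have : μ (symmDiff B C) = μ (symmDiff D C) :=
    measure_congr (hBD.symmDiff (Filter.EventuallyEq.refl _ _))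
  rw [this]
  exact hDC.trans_le (min_le_left _ _)

end RosAux

/-- If `K` is Rosenthal compact (homeomorphic to a compact subset of the space of
Baire-one functions on some Polish space, with the pointwise topology), then every Radon
probability measure on `K` has countable Maharam type. -/
theorem stmt3 (K : Type*) [TopologicalSpace K] [CompactSpace K] [T2Space K]
    (h : ∃ (X : Type) (_ : TopologicalSpace X) (_ : PolishSpace X) (e : K → X → ℝ),
      Continuous e ∧ Function.Injective e ∧
      ∀ k : K, ∃ g : ℕ → X → ℝ, (∀ n, Continuous (g n)) ∧
        ∀ x : X, Filter.Tendsto (fun n => g n x) Filter.atTop (nhds (e k x))) :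
    ∀ μ : RadonProb K, HasCountableType μ.1 := by
  obtain ⟨X, _, _, e, he, hinj, hb⟩ := h
  rintro ⟨μ, hμ, hreg⟩
  letI : MeasurableSpace K := borel K
  haveI : BorelSpace K := ⟨rfl⟩
  haveI := hμ
  haveI := hreg
  exact RosAux.main μ e he hinj hb
end
end
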